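/- arXiv:2103.05731 — 2 statements merged into one kernel-verified Lean document; each statement's English description precedes it below -/
import Mathlib

section
/- Let f ∈ ℤ[X] be nonconstant, squarefree (in ℚ[X]) and weakly intersective. Then the set of prime numbers ℓ such that f has no root in the ring ℤ_ℓ of ℓ-adic integers is finite. -/
open Polynomial

/-- The radical of an integer: the product of its distinct prime factors. -/
def IntRadical (m : ℤ) : ℕ := ∏ p ∈ m.natAbs.primeFactors, p

/-- The abc conjecture of Masser–Oesterlé. -/
def ABCConjecture : Prop :=
  ∀ ε : ℝ, 0 < ε → ∃ K : ℝ, 0 < K ∧ ∀ a b c : ℤ,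
    a ≠ 0 → b ≠ 0 → c ≠ 0 →
    IsCoprime a b → IsCoprime a c → IsCoprime b c →
    a + b = c →
    ((max (max |a| |b|) |c| : ℤ) : ℝ) ≤ K * (IntRadical (a * b * c) : ℝ) ^ (1 + ε)

/-- `d` is `n`-th power free. -/
def NthPowerFree (n : ℕ) (d : ℤ) : Prop :=
  d ≠ 0 ∧ ∀ p : ℕ, p.Prime → ¬ ((p : ℤ) ^ n ∣ d)

/-- A `K`-point of the twist `C_d : d·y^n = f(x)`. -/
def HasTwistPoint (n : ℕ) (f : Polynomial ℤ) (d : ℤ) (K : Type) [CommRing K] : Prop :=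
  ∃ x y : K, (d : K) * y ^ n = Polynomial.aeval x f

/-- The twist `C_d : d·y^n = f(x)` has points everywhere locally. -/
def EverywhereLocallySoluble (n : ℕ) (f : Polynomial ℤ) (d : ℤ) : Prop :=
  HasTwistPoint n f d ℝ ∧ ∀ (p : ℕ) (_ : Fact p.Prime), HasTwistPoint n f d ℚ_[p]

/-- The twist `C_d` violates the Hasse principle. -/
def ViolatesHasse (n : ℕ) (f : Polynomial ℤ) (d : ℤ) : Prop :=
  EverywhereLocallySoluble n f d ∧ ¬ HasTwistPoint n f d ℚ

/-- `f` is weakly intersective: the primes modulo which `f` has a root have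
relative natural density `1` in the primes. -/
def WeaklyIntersective (f : Polynomial ℤ) : Prop :=
  Filter.Tendsto (fun X : ℕ =>
      (Nat.card {ℓ : ℕ // ℓ ≤ X ∧ ℓ.Prime ∧ ∃ x : ZMod ℓ, Polynomial.aeval x f = 0} : ℝ) /
      (Nat.card {ℓ : ℕ // ℓ ≤ X ∧ ℓ.Prime} : ℝ))
    Filter.atTop (nhds 1)

section IdealCount

variable (L : Type*) [Field L] [NumberField L]

open NumberField Ideal UniqueFactorizationMonoid

/-- The number of ideals of norm `n` in the ring of integers of `L`. -/
noncomputable def idealCount (n : ℕ) : ℕ := Nat.card {I : Ideal (𝓞 L) // absNorm I = n}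

instance finite_absNorm_eq (n : ℕ) : Finite {I : Ideal (𝓞 L) // absNorm I = n} :=
  (finite_setOfPred_absNorm_eq n).to_subtype

lemma idealCount_one : idealCount L 1 = 1 := by
  simp [idealCount, absNorm_eq_one_iff]

variable {L} in
lemma sup_mul_sup_eq_of_coprime {m n : ℕ} (h : m.Coprime n) {I : Ideal (𝓞 L)}
    (hI : absNorm I = m * n) :
    (I ⊔ span {(m : 𝓞 L)}) * (I ⊔ span {(n : 𝓞 L)}) = I := by
  have hcop : span {(m : 𝓞 L)} ⊔ span {(n : 𝓞 L)} = ⊤ := by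
    rw [← isCoprime_iff_sup_eq, isCoprime_span_singleton_iff]
    exact_mod_cast (Nat.isCoprime_iff_coprime.mpr h).intCast (R := 𝓞 L)
  have hmn : span {(m : 𝓞 L)} * span {(n : 𝓞 L)} ≤ I := by
    rw [span_singleton_mul_span_singleton, ← Nat.cast_mul, ← hI]
    exact span_singleton_absNorm_le I
  apply le_antisymm
  · rw [Ideal.sup_mul, Ideal.mul_sup, Ideal.mul_sup]
    exact sup_le (sup_le Ideal.mul_le_left Ideal.mul_le_left) (sup_le Ideal.mul_le_right hmn)
  · calc I = I * (span {(m : 𝓞 L)} ⊔ span {(n : 𝓞 L)}) := by rw [hcop, mul_top]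
      _ ≤ _ := by
        rw [Ideal.mul_sup]
        refine sup_le ?_ ?_
        · rw [mul_comm]; exact mul_mono le_sup_right le_sup_left
        · exact mul_mono le_sup_left le_sup_right

variable {L} in
lemma isCoprime_of_coprime_absNorm {I J : Ideal (𝓞 L)} (h : (absNorm I).Coprime (absNorm J)) :
    IsCoprime I J := by
  rw [isCoprime_iff_exists]
  obtain ⟨a, b, hab⟩ := (Nat.isCoprime_iff_coprime.mpr h).intCast (R := 𝓞 L)
  exact ⟨_, I.mul_mem_left a (by exact_mod_cast absNorm_mem I), _,
    J.mul_mem_left b (by exact_mod_cast absNorm_mem J), hab⟩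

lemma absNorm_sup_span_coprime {m n : ℕ} (h : m.Coprime n) (I : Ideal (𝓞 L)) :
    (absNorm (I ⊔ span {(m : 𝓞 L)})).Coprime n := by
  have : absNorm (I ⊔ span {(m : 𝓞 L)}) ∣ m ^ Module.finrank ℤ (𝓞 L) := by
    rw [← absNorm_span_natCast]
    exact absNorm_dvd_absNorm_of_le le_sup_right
  exact Nat.Coprime.of_dvd_left this (h.pow_left _)

lemma idealCount_mul {m n : ℕ} (h : m.Coprime n) :
    idealCount L (m * n) = idealCount L m * idealCount L n := by
  rw [idealCount, idealCount, idealCount, ← Nat.card_prod]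
  symm
  refine Nat.card_congr (Equiv.ofBijective (fun x ↦ ⟨x.1.1 * x.2.1, by
    rw [_root_.map_mul, x.1.2, x.2.2]⟩) ⟨?_, ?_⟩)
  · rintro ⟨⟨A, hA⟩, ⟨B, hB⟩⟩ ⟨⟨A', hA'⟩, ⟨B', hB'⟩⟩ hAB
    simp only [Subtype.mk.injEq] at hAB
    have h1 : A = A' := by
      apply dvd_antisymm'
      · exact (isCoprime_of_coprime_absNorm (by rwa [hA', hB])).dvd_of_dvd_mul_right
          (hAB ▸ dvd_mul_right A' B')
      · exact (isCoprime_of_coprime_absNorm (by rwa [hA, hB'])).dvd_of_dvd_mul_right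
          (hAB ▸ dvd_mul_right A B)
    have h2 : B = B' := by
      apply dvd_antisymm'
      · exact (isCoprime_of_coprime_absNorm (by rw [hA, hB']; exact h.symm)).dvd_of_dvd_mul_left
          (hAB ▸ dvd_mul_left B' A')
      · exact (isCoprime_of_coprime_absNorm (by rw [hA', hB]; exact h.symm)).dvd_of_dvd_mul_left
          (hAB ▸ dvd_mul_left B A)
    simp [h1, h2]
  · rintro ⟨I, hI⟩
    have e := sup_mul_sup_eq_of_coprime h hI
    set A := I ⊔ span {(m : 𝓞 L)} with hA
    set B := I ⊔ span {(n : 𝓞 L)} with hB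
    have hN : absNorm A * absNorm B = m * n := by rw [← _root_.map_mul, e, hI]
    have cA : (absNorm A).Coprime n := absNorm_sup_span_coprime L h I
    have cB : (absNorm B).Coprime m := absNorm_sup_span_coprime L h.symm I
    have dA : absNorm A = m := Nat.dvd_antisymm (cA.dvd_of_dvd_mul_right (hN ▸ dvd_mul_right _ _))
      (cB.symm.dvd_of_dvd_mul_right (hN ▸ dvd_mul_right _ _))
    have dB : absNorm B = n := Nat.dvd_antisymm (cB.dvd_of_dvd_mul_left (hN ▸ dvd_mul_left _ _))
      (cA.symm.dvd_of_dvd_mul_left (hN ▸ dvd_mul_left _ _))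
    exact ⟨⟨⟨A, dA⟩, ⟨B, dB⟩⟩, Subtype.ext e⟩

lemma idealCount_prime_pow_le {p : ℕ} (hp : p.Prime) (k : ℕ) :
    idealCount L (p ^ k) ≤ (k + 1) ^ Module.finrank ℚ L := by
  classical
  have hpm : (span {(p : ℤ)}).IsMaximal :=
    have := Fact.mk hp
    Int.ideal_span_isMaximal_of_prime p
  have hp0 : span {(p : ℤ)} ≠ ⊥ := by simpa using hp.ne_zero
  set S := IsDedekindDomain.primesOverFinset (span {(p : ℤ)}) (𝓞 L) with hS
  have hne {I : Ideal (𝓞 L)} (hI : absNorm I = p ^ k) : I ≠ 0 := by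
    rintro rfl
    exact pow_ne_zero k hp.ne_zero (by simpa using hI.symm)
  have hmem {I P : Ideal (𝓞 L)} (hI : absNorm I = p ^ k) (hP : P ∈ normalizedFactors I) :
      P ∈ S := by
    have hPp := prime_of_normalized_factor P hP
    have hPprime := isPrime_of_prime hPp
    rw [hS, IsDedekindDomain.mem_primesOverFinset_iff hp0]
    refine ⟨hPprime, ⟨hpm.eq_of_le (IsPrime.under ℤ P).ne_top ?_⟩⟩
    rw [span_singleton_le_iff_mem, mem_comap]
    refine hPprime.mem_of_pow_mem k ?_
    have := le_of_dvd (dvd_of_mem_normalizedFactors hP) (absNorm_mem I)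
    rw [hI] at this
    simpa using this
  have hcount {I : Ideal (𝓞 L)} (hI : absNorm I = p ^ k) (P : S) :
      (normalizedFactors I).count P.1 < k + 1 := by
    by_cases hP : P.1 ∈ normalizedFactors I
    swap
    · simp [Multiset.count_eq_zero_of_notMem hP]
    have hdvd : P.1 ^ (normalizedFactors I).count P.1 ∣ I :=
      pow_dvd_of_le_emultiplicity <| by
        rw [emultiplicity_eq_count_normalizedFactors
          (irreducible_of_normalized_factor _ hP) (hne hI), normalize_eq]
    have h1 := absNorm_dvd_absNorm_of_le (le_of_dvd hdvd)
    rw [hI, map_pow] at h1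
    have h2 : absNorm P.1 ∣ p ^ k := hI ▸ absNorm_dvd_absNorm_of_le
      (le_of_dvd (dvd_of_mem_normalizedFactors hP))
    obtain ⟨j, -, hj⟩ := (Nat.dvd_prime_pow hp).mp h2
    have hj0 : j ≠ 0 := by
      rintro rfl
      rw [pow_zero, absNorm_eq_one_iff] at hj
      exact (isPrime_of_prime (prime_of_normalized_factor _ hP)).ne_top hj
    rw [hj, ← pow_mul] at h1
    have := (Nat.pow_dvd_pow_iff_le_right hp.one_lt).mp h1
    nlinarith [Nat.pos_of_ne_zero hj0]
  let F : {I : Ideal (𝓞 L) // absNorm I = p ^ k} → (S → Fin (k + 1)) :=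
    fun I P ↦ ⟨(normalizedFactors I.1).count P.1, hcount I.2 P⟩
  have hF : Function.Injective F := by
    rintro ⟨I, hI⟩ ⟨J, hJ⟩ hIJ
    have : normalizedFactors I = normalizedFactors J := by
      ext P
      by_cases hP : P ∈ S
      · simpa [F] using congrFun hIJ ⟨P, hP⟩
      · rw [Multiset.count_eq_zero_of_notMem (fun h ↦ hP (hmem hI h)),
          Multiset.count_eq_zero_of_notMem (fun h ↦ hP (hmem hJ h))]
    have := (associated_iff_normalizedFactors_eq_normalizedFactors (hne hI) (hne hJ)).mpr this
    exact Subtype.ext (associated_iff_eq.mp this)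
  calc idealCount L (p ^ k) ≤ Nat.card (S → Fin (k + 1)) := Nat.card_le_card_of_injective F hF
    _ = (k + 1) ^ S.card := by simp
    _ ≤ _ := Nat.pow_le_pow_right (by omega) (card_primesOverFinset_le_finrank _ ℚ L hp0)

end IdealCount

section PrimeMean

open Filter Topology

/-- The Dirichlet series `∑ φ(p) p⁻ˢ` over the primes. -/
noncomputable def primeSum (φ : ℕ → ℝ) (s : ℝ) : ℝ := ∑' p : Nat.Primes, φ p * (p : ℝ) ^ (-s)

/-- `φ` is bounded and has mean value `c` over the primes, in the sense of Dirichlet density. -/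
def HasPrimeMean (φ : ℕ → ℝ) (c : ℝ) : Prop :=
  (∃ C, ∀ p : Nat.Primes, |φ p| ≤ C) ∧
    Tendsto (fun s ↦ primeSum φ s / Real.log (1 / (s - 1))) (𝓝[>] 1) (𝓝 c)

lemma tendsto_log_one_div_sub_one :
    Tendsto (fun s : ℝ ↦ Real.log (1 / (s - 1))) (𝓝[>] 1) atTop := by
  refine Real.tendsto_log_atTop.comp ?_
  simp only [one_div]
  refine tendsto_inv_nhdsGT_zero.comp ?_
  refine tendsto_nhdsWithin_iff.mpr ⟨?_, ?_⟩
  · have : Tendsto (fun s : ℝ ↦ s - 1) (𝓝 1) (𝓝 (1 - 1)) := tendsto_id.sub_const 1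
    rw [sub_self] at this
    exact this.mono_left nhdsWithin_le_nhds
  · filter_upwards [self_mem_nhdsWithin] with s hs
    exact sub_pos.mpr (Set.mem_Ioi.mp hs)

lemma tendsto_div_log_of_bounded {h : ℝ → ℝ} {C : ℝ} (hb : ∀ᶠ s in 𝓝[>] 1, |h s| ≤ C) :
    Tendsto (fun s ↦ h s / Real.log (1 / (s - 1))) (𝓝[>] 1) (𝓝 0) := by
  have h1 := tendsto_log_one_div_sub_one.inv_tendsto_atTop.const_mul C
  rw [mul_zero] at h1
  refine squeeze_zero_norm' ?_ h1
  filter_upwards [hb, tendsto_log_one_div_sub_one.eventually_gt_atTop 0] with s hs hpos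
  rw [norm_div, Real.norm_eq_abs, Real.norm_eq_abs, abs_of_pos hpos, div_eq_mul_inv]
  exact mul_le_mul_of_nonneg_right hs (inv_nonneg.mpr hpos.le)

lemma summable_primes_of_bounded {φ : ℕ → ℝ} {C : ℝ} (h : ∀ p : Nat.Primes, |φ p| ≤ C) {s : ℝ}
    (hs : 1 < s) : Summable (fun p : Nat.Primes ↦ φ p * (p : ℝ) ^ (-s)) := by
  refine Summable.of_norm_bounded
    ((Nat.Primes.summable_rpow (r := -s)).mpr (by linarith) |>.mul_left C) fun p ↦ ?_
  rw [norm_mul, Real.norm_eq_abs, Real.norm_of_nonneg (by positivity)]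
  exact mul_le_mul_of_nonneg_right (h p) (by positivity)

lemma HasPrimeMean.add {φ ψ : ℕ → ℝ} {c d : ℝ} (hφ : HasPrimeMean φ c) (hψ : HasPrimeMean ψ d) :
    HasPrimeMean (fun p ↦ φ p + ψ p) (c + d) := by
  obtain ⟨⟨C, hC⟩, h1⟩ := hφ
  obtain ⟨⟨D, hD⟩, h2⟩ := hψ
  refine ⟨⟨C + D, fun p ↦ (abs_add_le _ _).trans (add_le_add (hC p) (hD p))⟩, ?_⟩
  refine (h1.add h2).congr' ?_
  filter_upwards [self_mem_nhdsWithin] with s hs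
  rw [← add_div, primeSum, primeSum, primeSum, ← (summable_primes_of_bounded hC hs).tsum_add
    (summable_primes_of_bounded hD hs)]
  simp only [add_mul]

lemma HasPrimeMean.const_mul {φ : ℕ → ℝ} {c : ℝ} (a : ℝ) (hφ : HasPrimeMean φ c) :
    HasPrimeMean (fun p ↦ a * φ p) (a * c) := by
  obtain ⟨⟨C, hC⟩, h1⟩ := hφ
  refine ⟨⟨|a| * C, fun p ↦ ?_⟩, ?_⟩
  · rw [abs_mul]
    exact mul_le_mul_of_nonneg_left (hC p) (abs_nonneg a)
  · refine (h1.const_mul a).congr fun s ↦ ?_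
    rw [primeSum, primeSum, ← mul_div_assoc, ← tsum_mul_left]
    simp only [mul_assoc]

lemma HasPrimeMean.sub {φ ψ : ℕ → ℝ} {c d : ℝ} (hφ : HasPrimeMean φ c) (hψ : HasPrimeMean ψ d) :
    HasPrimeMean (fun p ↦ φ p - ψ p) (c - d) := by
  simpa [sub_eq_add_neg] using hφ.add (hψ.const_mul (-1))

lemma HasPrimeMean.zero : HasPrimeMean (fun _ ↦ 0) 0 :=
  ⟨⟨0, fun _ ↦ by simp⟩, by simp [primeSum]⟩

lemma HasPrimeMean.sum {ι : Type*} (S : Finset ι) {φ : ι → ℕ → ℝ} {c : ι → ℝ}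
    (h : ∀ i ∈ S, HasPrimeMean (φ i) (c i)) :
    HasPrimeMean (fun p ↦ ∑ i ∈ S, φ i p) (∑ i ∈ S, c i) := by
  classical
  induction S using Finset.induction_on with
  | empty => simpa using HasPrimeMean.zero
  | insert i S hi ih =>
    simp only [Finset.sum_insert hi]
    exact (h i (Finset.mem_insert_self _ _)).add
      (ih fun j hj ↦ h j (Finset.mem_insert_of_mem hj))

lemma hasPrimeMean_zero_of_finite {φ : ℕ → ℝ} (h : {p : Nat.Primes | φ p ≠ 0}.Finite) :
    HasPrimeMean φ 0 := by
  classical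
  have h0 (p : Nat.Primes) (hp : p ∉ h.toFinset) : φ p = 0 := by simpa using hp
  have hle (p : Nat.Primes) : |φ p| ≤ ∑ q ∈ h.toFinset, |φ q| := by
    by_cases hp : p ∈ h.toFinset
    · exact Finset.single_le_sum (f := fun q : Nat.Primes ↦ |φ q|) (fun _ _ ↦ abs_nonneg _) hp
    · rw [h0 p hp, abs_zero]
      exact Finset.sum_nonneg fun _ _ ↦ abs_nonneg _
  refine ⟨⟨_, hle⟩, tendsto_div_log_of_bounded (C := ∑ q ∈ h.toFinset, |φ q|) ?_⟩
  filter_upwards [self_mem_nhdsWithin] with s hs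
  rw [primeSum, tsum_eq_sum (s := h.toFinset) fun p hp ↦ by rw [h0 p hp, zero_mul]]
  refine (Finset.abs_sum_le_sum_abs _ _).trans (Finset.sum_le_sum fun p _ ↦ ?_)
  rw [abs_mul, abs_of_nonneg (a := (p : ℝ) ^ (-s)) (by positivity)]
  exact mul_le_of_le_one_right (abs_nonneg _)
    (Real.rpow_le_one_of_one_le_of_nonpos (by exact_mod_cast p.2.one_le)
      (by have := Set.mem_Ioi.mp hs; linarith))

lemma HasPrimeMean.congr {φ ψ : ℕ → ℝ} {c : ℝ} (hφ : HasPrimeMean φ c)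
    (h : {p : Nat.Primes | ψ p ≠ φ p}.Finite) : HasPrimeMean ψ c := by
  have := (hasPrimeMean_zero_of_finite (φ := fun p ↦ ψ p - φ p)
    (by simpa [sub_eq_zero] using h)).add hφ
  simpa using this

end PrimeMean

section DedekindZeta

open NumberField Filter Topology

variable (L : Type*) [Field L] [NumberField L]

lemma sum_idealCount_isBigO :
    (fun n : ℕ ↦ ∑ k ∈ Finset.Icc 1 n, (idealCount L k : ℝ)) =O[atTop]
      fun n ↦ (n : ℝ) ^ (1 : ℝ) := by
  have h := ((Ideal.tendsto_norm_le_div_atTop₀ L).comp tendsto_natCast_atTop_atTop).isBigO_one ℝ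
  have h2 := h.mul (Asymptotics.isBigO_refl (fun n : ℕ ↦ (n : ℝ)) atTop)
  refine (h2.congr' ?_ ?_)
  · filter_upwards [eventually_gt_atTop 0] with n hn
    have hn' : (n : ℝ) ≠ 0 := by exact_mod_cast hn.ne'
    simp only [Function.comp_apply, Nat.cast_le]
    rw [div_mul_cancel₀ _ hn', ← Nat.cast_sum]
    congr 1
    rw [← add_left_inj 1, ← Ideal.card_norm_le_eq_card_norm_le_add_one,
      show Finset.Icc 1 n = Finset.Ioc 0 n from Finset.Icc_succ_left_eq_Ioc _ _,
      show 1 = idealCount L 0 by simp [idealCount, Ideal.absNorm_eq_zero_iff],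
      Finset.sum_Ioc_add_eq_sum_Icc (n.zero_le)]
    simp only [idealCount]
    rw [← Finset.card_preimage_eq_sum_card_image_eq
        (fun k _ ↦ Ideal.finite_setOfPred_absNorm_eq k)]
    simp [Set.coe_eq_subtype]
  · filter_upwards with n using by simp

lemma idealCount_term_eq {s : ℝ} (hs : 1 < s) (n : ℕ) :
    LSeries.term (fun n ↦ ((idealCount L n : ℝ) : ℂ)) s n =
      ((idealCount L n * (n : ℝ) ^ (-s) : ℝ) : ℂ) := by
  rcases eq_or_ne n 0 with rfl | hn
  · rw [LSeries.term_zero, Nat.cast_zero, Real.zero_rpow (by linarith)]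
    simp
  · rw [LSeries.term_of_ne_zero hn, Complex.ofReal_mul,
      Complex.ofReal_cpow (Nat.cast_nonneg n), Complex.ofReal_neg, Complex.cpow_neg]
    simp [div_eq_mul_inv]

lemma summable_idealCount {s : ℝ} (hs : 1 < s) :
    Summable (fun n : ℕ ↦ (idealCount L n : ℝ) * (n : ℝ) ^ (-s)) := by
  have := LSeriesSummable_of_sum_norm_bigO_and_nonneg (s := (s : ℂ)) (sum_idealCount_isBigO L)
    (fun _ ↦ Nat.cast_nonneg _) zero_le_one (by simpa using hs)
  rw [LSeriesSummable, funext (idealCount_term_eq L hs)] at this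
  exact Complex.summable_ofReal.mp this

lemma dedekindZeta_eq_tsum {s : ℝ} (hs : 1 < s) :
    dedekindZeta L s = ((∑' n : ℕ, (idealCount L n : ℝ) * (n : ℝ) ^ (-s) : ℝ) : ℂ) := by
  rw [Complex.ofReal_tsum, ← tsum_congr (idealCount_term_eq L hs)]
  rfl

lemma tendsto_sub_one_mul_tsum_idealCount :
    Tendsto (fun s : ℝ ↦ (s - 1) * ∑' n : ℕ, (idealCount L n : ℝ) * (n : ℝ) ^ (-s))
      (𝓝[>] 1) (𝓝 (dedekindZeta_residue L)) := by
  have h := (Complex.continuous_re.tendsto _).comp (tendsto_sub_one_mul_dedekindZeta_nhdsGT L)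
  rw [Complex.ofReal_re] at h
  refine h.congr' ?_
  filter_upwards [self_mem_nhdsWithin] with s hs
  rw [Function.comp_apply, dedekindZeta_eq_tsum L hs, ← Complex.ofReal_one, ← Complex.ofReal_sub,
    ← Complex.ofReal_mul, Complex.ofReal_re]

end DedekindZeta

section EulerProduct

open NumberField Filter Topology

variable (L : Type*) [Field L] [NumberField L]

lemma idealCount_prime_le {p : ℕ} (hp : p.Prime) :
    (idealCount L p : ℝ) ≤ 2 ^ Module.finrank ℚ L := by
  have := idealCount_prime_pow_le L hp 1
  rw [pow_one] at this
  exact_mod_cast this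

lemma summable_add_three_pow_mul_half_pow (d : ℕ) :
    Summable (fun e : ℕ ↦ ((e : ℝ) + 3) ^ d * (1 / 2 : ℝ) ^ e) := by
  have h := summable_pow_mul_geometric_of_norm_lt_one (R := ℝ) d (r := 1 / 2)
    (by rw [Real.norm_eq_abs, abs_of_pos] <;> norm_num)
  have h3 := ((summable_nat_add_iff 3).mpr h).mul_left 8
  refine h3.congr fun e ↦ ?_
  push_cast
  ring

lemma eulerFactor_tail_term_le {p : ℕ} (hp : p.Prime) {s : ℝ} (hs : 1 < s) (e : ℕ) :
    (idealCount L (p ^ (e + 2)) : ℝ) * ((p ^ (e + 2) : ℕ) : ℝ) ^ (-s) ≤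
      ((p : ℝ) ^ 2)⁻¹ * (((e : ℝ) + 3) ^ Module.finrank ℚ L * (1 / 2 : ℝ) ^ e) := by
  have h1 : (idealCount L (p ^ (e + 2)) : ℝ) ≤ ((e : ℝ) + 3) ^ Module.finrank ℚ L := by
    have := idealCount_prime_pow_le L hp (e + 2)
    have h : (idealCount L (p ^ (e + 2)) : ℝ) ≤ ((e + 2 + 1 : ℕ) : ℝ) ^ Module.finrank ℚ L := by
      exact_mod_cast this
    refine h.trans_eq ?_
    push_cast
    ring
  have hp2 : (2 : ℝ) ≤ p := by exact_mod_cast hp.two_le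
  have h2 : ((p ^ (e + 2) : ℕ) : ℝ) ^ (-s) ≤ ((p : ℝ) ^ 2)⁻¹ * (1 / 2 : ℝ) ^ e := by
    calc ((p ^ (e + 2) : ℕ) : ℝ) ^ (-s) ≤ ((p ^ (e + 2) : ℕ) : ℝ) ^ (-1 : ℝ) :=
          Real.rpow_le_rpow_of_exponent_le
            (by exact_mod_cast Nat.one_le_pow _ _ hp.pos) (by linarith)
      _ = ((p : ℝ) ^ 2)⁻¹ * ((p : ℝ)⁻¹) ^ e := by
          rw [Real.rpow_neg_one]
          push_cast
          rw [pow_add, mul_inv, mul_comm, inv_pow]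
      _ ≤ _ := by
          gcongr
          rw [one_div]
          exact inv_anti₀ two_pos hp2
  calc _ ≤ ((e : ℝ) + 3) ^ Module.finrank ℚ L * (((p : ℝ) ^ 2)⁻¹ * (1 / 2 : ℝ) ^ e) :=
        mul_le_mul h1 h2 (by positivity) (by positivity)
    _ = _ := by ring

lemma exists_abs_log_eulerFactor_sub_le : ∃ C : ℝ, ∀ p : ℕ, p.Prime → ∀ s : ℝ, 1 < s →
    0 < ∑' e, (idealCount L (p ^ e) : ℝ) * ((p ^ e : ℕ) : ℝ) ^ (-s) ∧
    |Real.log (∑' e, (idealCount L (p ^ e) : ℝ) * ((p ^ e : ℕ) : ℝ) ^ (-s)) -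
      idealCount L p * (p : ℝ) ^ (-s)| ≤ C * (p : ℝ) ^ (-2 : ℝ) := by
  set d := Module.finrank ℚ L
  have hsum := summable_add_three_pow_mul_half_pow d
  set T := ∑' e : ℕ, ((e : ℝ) + 3) ^ d * (1 / 2 : ℝ) ^ e
  have hT : 0 ≤ T := tsum_nonneg fun e ↦ by positivity
  refine ⟨T + 2 ^ d * 2 ^ d, fun p hp s hs ↦ ?_⟩
  have hf : Summable fun e ↦ (idealCount L (p ^ e) : ℝ) * ((p ^ e : ℕ) : ℝ) ^ (-s) :=
    (summable_idealCount L hs).comp_injective (Nat.pow_right_injective hp.two_le)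
  have hsplit := hf.sum_add_tsum_nat_add 2
  set E := ∑' e, (idealCount L (p ^ e) : ℝ) * ((p ^ e : ℕ) : ℝ) ^ (-s)
  set R := ∑' e, (idealCount L (p ^ (e + 2)) : ℝ) * ((p ^ (e + 2) : ℕ) : ℝ) ^ (-s)
  set y := (idealCount L p : ℝ) * (p : ℝ) ^ (-s)
  have hE : 1 + y + R = E := by
    rw [← hsplit]
    simp [Finset.sum_range_succ, idealCount_one, y, R]
  have hR0 : 0 ≤ R := tsum_nonneg fun e ↦ by positivity
  have hR : R ≤ T * ((p : ℝ) ^ 2)⁻¹ := by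
    rw [mul_comm, ← tsum_mul_left]
    exact ((summable_nat_add_iff 2).mpr hf).tsum_le_tsum (eulerFactor_tail_term_le L hp hs)
      (hsum.mul_left _)
  have hy0 : 0 ≤ y := by positivity
  have hp1 : (1 : ℝ) ≤ p := by exact_mod_cast hp.one_le
  have hy : y ≤ 2 ^ d * (p : ℝ)⁻¹ := by
    refine mul_le_mul (idealCount_prime_le L hp) ?_ (by positivity) (by positivity)
    rw [← Real.rpow_neg_one]
    exact Real.rpow_le_rpow_of_exponent_le hp1 (by linarith)
  have hyy : y ^ 2 ≤ 2 ^ d * 2 ^ d * ((p : ℝ) ^ 2)⁻¹ := by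
    calc y ^ 2 ≤ (2 ^ d * (p : ℝ)⁻¹) ^ 2 := pow_le_pow_left₀ hy0 hy 2
      _ = _ := by rw [mul_pow, inv_pow]; ring
  have hp2 : (p : ℝ) ^ (-2 : ℝ) = ((p : ℝ) ^ 2)⁻¹ := by
    rw [Real.rpow_neg (by positivity)]
    norm_num
  have hEpos : 0 < E := by linarith
  refine ⟨hEpos, ?_⟩
  rw [hp2, abs_le, add_mul]
  have hTp : 0 ≤ T * ((p : ℝ) ^ 2)⁻¹ := by positivity
  have hdp : 0 ≤ (2 : ℝ) ^ d * 2 ^ d * ((p : ℝ) ^ 2)⁻¹ := by positivity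
  constructor
  · have h1 := Real.one_sub_inv_le_log_of_pos hEpos
    have h2 : E⁻¹ ≤ (1 + y)⁻¹ := inv_anti₀ (by linarith) (by linarith)
    have h3 : (1 + y)⁻¹ ≤ 1 - y + y ^ 2 := by
      rw [inv_le_iff_one_le_mul₀ (by linarith)]
      nlinarith [pow_nonneg hy0 3]
    linarith
  · have := Real.log_le_sub_one_of_pos hEpos
    linarith

lemma exists_abs_log_tsum_sub_primeSum_le : ∃ B : ℝ, ∀ s : ℝ, 1 < s →
    0 < ∑' n : ℕ, (idealCount L n : ℝ) * (n : ℝ) ^ (-s) ∧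
    |Real.log (∑' n : ℕ, (idealCount L n : ℝ) * (n : ℝ) ^ (-s)) -
      primeSum (fun p ↦ idealCount L p) s| ≤ B := by
  obtain ⟨C, hC⟩ := exists_abs_log_eulerFactor_sub_le L
  have hsq : Summable fun p : Nat.Primes ↦ C * (p : ℝ) ^ (-2 : ℝ) :=
    (Nat.Primes.summable_rpow.mpr (by norm_num)).mul_left C
  refine ⟨∑' p : Nat.Primes, C * (p : ℝ) ^ (-2 : ℝ), fun s hs ↦ ?_⟩
  set E : Nat.Primes → ℝ := fun p ↦
    ∑' e, (idealCount L ((p : ℕ) ^ e) : ℝ) * (((p : ℕ) ^ e : ℕ) : ℝ) ^ (-s)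
  have hprod : HasProd E (∑' n : ℕ, (idealCount L n : ℝ) * (n : ℝ) ^ (-s)) := by
    refine EulerProduct.eulerProduct_hasProd
      (f := fun n : ℕ ↦ (idealCount L n : ℝ) * (n : ℝ) ^ (-s)) ?_ ?_ ?_ ?_
    · simp [idealCount_one]
    · intro m n h
      simp only [idealCount_mul L h, Nat.cast_mul]
      rw [Real.mul_rpow (Nat.cast_nonneg _) (Nat.cast_nonneg _)]
      ring
    · exact (summable_idealCount L hs).norm
    · simp [Real.zero_rpow (show -s ≠ 0 by linarith)]
  have hy := summable_primes_of_bounded (φ := fun p ↦ (idealCount L p : ℝ))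
    (fun p ↦ by
      rw [abs_of_nonneg (Nat.cast_nonneg _)]
      exact idealCount_prime_le L p.2) hs
  have hdiff : Summable fun p : Nat.Primes ↦
      Real.log (E p) - idealCount L p * (p : ℝ) ^ (-s) :=
    Summable.of_norm_bounded hsq fun p ↦ (hC p p.2 s hs).2
  have hlog : Summable fun p : Nat.Primes ↦ Real.log (E p) := by
    simpa using hdiff.add hy
  have hexp : HasProd E (Real.exp (∑' p, Real.log (E p))) := by
    have := hlog.hasSum.rexp
    rwa [show Real.exp ∘ (fun p ↦ Real.log (E p)) = E from
      funext fun p ↦ Real.exp_log (hC p p.2 s hs).1] at this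
  rw [hprod.unique hexp]
  refine ⟨Real.exp_pos _, ?_⟩
  rw [Real.log_exp, primeSum, ← hlog.tsum_sub hy, ← Real.norm_eq_abs]
  exact tsum_of_norm_bounded hsq.hasSum fun p ↦ (hC p p.2 s hs).2

/-- The number of degree one primes of `L` above `p` is `1` on average. -/
theorem hasPrimeMean_idealCount : HasPrimeMean (fun p ↦ idealCount L p) 1 := by
  refine ⟨⟨_, fun p ↦ by
    rw [abs_of_nonneg (Nat.cast_nonneg _)]
    exact idealCount_prime_le L p.2⟩, ?_⟩
  obtain ⟨B, hB⟩ := exists_abs_log_tsum_sub_primeSum_le L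
  set ζ : ℝ → ℝ := fun s ↦ ∑' n : ℕ, (idealCount L n : ℝ) * (n : ℝ) ^ (-s)
  have h1 : Tendsto (fun s ↦ (Real.log (ζ s) - primeSum (fun p ↦ idealCount L p) s) /
      Real.log (1 / (s - 1))) (𝓝[>] 1) (𝓝 0) :=
    tendsto_div_log_of_bounded (C := B) <| by
      filter_upwards [self_mem_nhdsWithin] with s hs using (hB s hs).2
  have h2 : Tendsto (fun s ↦ Real.log ((s - 1) * ζ s) / Real.log (1 / (s - 1))) (𝓝[>] 1)
      (𝓝 0) := by
    have h := (Real.continuousAt_log (dedekindZeta_residue_pos L).ne').tendsto.comp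
      (tendsto_sub_one_mul_tsum_idealCount L)
    have := h.mul tendsto_log_one_div_sub_one.inv_tendsto_atTop
    rw [mul_zero] at this
    exact this
  have h3 := (h2.sub h1).const_add 1
  rw [sub_zero, add_zero] at h3
  refine h3.congr' ?_
  filter_upwards [self_mem_nhdsWithin,
    tendsto_log_one_div_sub_one.eventually_gt_atTop 0] with s hs hpos
  have hs' : 0 < s - 1 := sub_pos.mpr (Set.mem_Ioi.mp hs)
  rw [Real.log_mul hs'.ne' (hB s hs).1.ne']
  have : Real.log (s - 1) = -Real.log (1 / (s - 1)) := by
    rw [one_div, Real.log_inv, neg_neg]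
  rw [this]
  field_simp
  ring

end EulerProduct

section RootCount

open NumberField Ideal RingOfIntegers

/-- The number of roots of `g` modulo `p`. -/
noncomputable def rootCount (g : ℤ[X]) (p : ℕ) : ℕ := Nat.card {x : ZMod p // aeval x g = 0}

variable {L : Type*} [Field L] [NumberField L]

lemma exponent_ne_zero {θ : 𝓞 L} (hθ : Algebra.adjoin ℚ {(θ : L)} = ⊤) : exponent θ ≠ 0 := by
  have h0 : conductor ℤ θ ≠ ⊥ := by
    intro h
    have h1 := conductor_mul_differentIdeal ℤ ℚ L θ hθ
    rw [h, Submodule.bot_mul, eq_comm, span_singleton_eq_bot] at h1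
    have h2 : aeval (algebraMap (𝓞 L) L θ) (derivative (minpoly ℚ (algebraMap (𝓞 L) L θ))) ≠ 0 :=
      (Algebra.IsSeparable.isSeparable _ _).aeval_derivative_ne_zero (minpoly.aeval _ _)
    rw [minpoly.isIntegrallyClosed_eq_field_fractions ℚ L θ.isIntegral, derivative_map,
      aeval_map_algebraMap, aeval_algebraMap_apply, h1, map_zero] at h2
    exact h2 rfl
  rw [exponent, Ne, absNorm_eq_zero_iff]
  exact fun h ↦ h0 (eq_bot_of_comap_eq_bot h)

lemma idealCount_eq_rootCount {θ : 𝓞 L} {p : ℕ} (hp : p.Prime) (hθ : ¬ p ∣ exponent θ) :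
    idealCount L p = rootCount (minpoly ℤ θ) p := by
  have := Fact.mk hp
  have hmon : (minpoly ℤ θ).Monic := minpoly.monic θ.isIntegral
  have hg0 : (minpoly ℤ θ).map (Int.castRingHom (ZMod p)) ≠ 0 := (hmon.map _).ne_zero
  let e := Ideal.primesOverSpanEquivMonicFactorsMod hθ
  have hmem (x : {x : ZMod p // aeval x (minpoly ℤ θ) = 0}) : X - C x.1 ∈ monicFactorsMod θ p := by
    rw [Multiset.mem_toFinset, Polynomial.mem_normalizedFactors_iff hg0]
    refine ⟨irreducible_X_sub_C _, monic_X_sub_C _, ?_⟩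
    rw [dvd_iff_isRoot, IsRoot, eval_map]
    exact x.2
  let F : {x : ZMod p // aeval x (minpoly ℤ θ) = 0} → {I : Ideal (𝓞 L) // absNorm I = p} :=
    fun x ↦ ⟨(e.symm ⟨_, hmem x⟩ : Ideal (𝓞 L)), by
      rw [← Ideal.pow_inertiaDeg p, inertiaDeg_primesOverSpanEquivMonicFactorsMod_symm_apply' hθ,
        natDegree_X_sub_C, pow_one]⟩
  symm
  refine Nat.card_congr (Equiv.ofBijective F ⟨fun x y hxy ↦ ?_, fun ⟨I, hI⟩ ↦ ?_⟩)
  · have h0 : (e.symm ⟨_, hmem x⟩ : Ideal (𝓞 L)) = e.symm ⟨_, hmem y⟩ :=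
      (congrArg Subtype.val hxy :)
    have h1 := e.symm.injective (Subtype.ext h0)
    have h2 : X - C x.1 = X - C y.1 := Subtype.ext_iff.mp h1
    exact Subtype.ext (C_injective (sub_right_injective h2))
  · have hIp : I.IsPrime := isPrime_of_irreducible_absNorm (hI ▸ hp.prime.irreducible)
    have hIl : I.LiesOver (span {(p : ℤ)}) := by
      refine ⟨(Int.ideal_span_isMaximal_of_prime p).eq_of_le (IsPrime.under ℤ I).ne_top ?_⟩
      rw [span_singleton_le_iff_mem, mem_comap]
      simpa [hI] using absNorm_mem I
    obtain ⟨⟨Q, hQ⟩, hQI⟩ := e.symm.surjective ⟨I, hIp, hIl⟩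
    have hdeg := inertiaDeg_primesOverSpanEquivMonicFactorsMod_symm_apply' hθ hQ
    change inertiaDeg (e.symm ⟨Q, hQ⟩ : Ideal (𝓞 L)) ℤ = _ at hdeg
    rw [hQI] at hdeg
    have h1 : I.inertiaDeg ℤ = 1 :=
      Nat.pow_right_injective hp.two_le (by simp [Ideal.pow_inertiaDeg, hI])
    rw [h1] at hdeg
    obtain ⟨-, hQm, hQd⟩ := (Polynomial.mem_normalizedFactors_iff hg0).mp
      (Multiset.mem_toFinset.mp hQ)
    have hQX := hQm.eq_X_add_C hdeg.symm
    have hroot : aeval (-Q.coeff 0) (minpoly ℤ θ) = 0 := by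
      rw [hQX, ← sub_neg_eq_add, ← C_neg, dvd_iff_isRoot, IsRoot, eval_map] at hQd
      exact hQd
    refine ⟨⟨-Q.coeff 0, hroot⟩, Subtype.ext ?_⟩
    change (e.symm _ : Ideal (𝓞 L)) = I
    have : (⟨X - C (-Q.coeff 0), hmem ⟨-Q.coeff 0, hroot⟩⟩ : monicFactorsMod θ p) = ⟨Q, hQ⟩ :=
      Subtype.ext (((congrArg (X - ·) (C_neg)).trans (sub_neg_eq_add _ _)).trans hQX.symm)
    rw [this, hQI]

theorem hasPrimeMean_rootCount {θ : 𝓞 L} (hθ : Algebra.adjoin ℚ {(θ : L)} = ⊤) :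
    HasPrimeMean (fun p ↦ rootCount (minpoly ℤ θ) p) 1 := by
  refine (hasPrimeMean_idealCount L).congr ?_
  refine (((exponent θ).primeFactors.finite_toSet).preimage
    (Nat.Primes.coe_nat_injective.injOn)).subset fun p hp ↦ ?_
  by_contra h
  refine hp ?_
  simp only [Set.mem_preimage, Finset.mem_coe, Nat.mem_primeFactors] at h
  simp only [idealCount_eq_rootCount p.2 fun hd ↦ h ⟨p.2, hd, exponent_ne_zero hθ⟩]

end RootCount

section ConjugacyCounts

variable {G : Type*} [Group G]

/-- The number of conjugates of `g` (counted by the conjugating element) that lie in `H`. -/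
noncomputable def conjMemCount (H : Subgroup G) (g : G) : ℕ := Nat.card {x : G // x⁻¹ * g * x ∈ H}

/-- The number of conjugates of `g` (counted by the conjugating element) that generate `H`. -/
noncomputable def conjGenCount (H : Subgroup G) (g : G) : ℕ :=
  Nat.card {x : G // Subgroup.zpowers (x⁻¹ * g * x) = H}

variable [Fintype G]

open Classical in
lemma conjMemCount_eq_sum (H : Subgroup G) (g : G) :
    conjMemCount H g = conjGenCount H g + ∑ H' with H' < H, conjGenCount H' g := by
  simp only [conjMemCount, conjGenCount, Nat.card_eq_fintype_card, Fintype.card_subtype]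
  rw [Finset.card_eq_sum_card_fiberwise (f := fun x ↦ Subgroup.zpowers (x⁻¹ * g * x))
    (t := {H' | H' ≤ H}) fun x hx ↦ by simpa using hx]
  have h : ({H' | H' ≤ H} : Finset (Subgroup G)) =
      insert H ({H' | H' < H} : Finset (Subgroup G)) := by
    ext H'
    simp [le_iff_eq_or_lt]
  rw [h, Finset.sum_insert (by simp)]
  congr 1
  · congr 1
    ext x
    simp only [Finset.mem_filter, Finset.mem_univ, true_and, and_iff_right_iff_imp]
    rintro rfl
    exact Subgroup.mem_zpowers _
  · refine Finset.sum_congr rfl fun H' hH' ↦ ?_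
    congr 1
    ext x
    simp only [Finset.mem_filter, Finset.mem_univ, true_and, and_iff_right_iff_imp]
    rintro rfl
    exact (Finset.mem_filter.mp hH').2.le (Subgroup.mem_zpowers _)

lemma sum_conjMemCount (H : Subgroup G) :
    ∑ g, conjMemCount H g = Fintype.card G * Nat.card H := by
  classical
  simp only [conjMemCount, Nat.card_eq_fintype_card, Fintype.card_subtype, Finset.card_filter]
  rw [Finset.sum_comm]
  have (x : G) : ∑ g : G, (if x⁻¹ * g * x ∈ H then 1 else 0) = Fintype.card H := by
    rw [← Finset.card_filter, ← Fintype.card_subtype]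
    refine Fintype.card_congr (((MulAut.conj x⁻¹).toEquiv).subtypeEquiv fun g ↦ ?_)
    simp
  simp [this, Fintype.card_subtype]

lemma hasPrimeMean_conjGenCount {σ : ℕ → G}
    (h : ∀ H : Subgroup G, HasPrimeMean (fun p ↦ conjMemCount H (σ p)) (Nat.card H))
    (H : Subgroup G) :
    HasPrimeMean (fun p ↦ conjGenCount H (σ p))
      ((∑ g, (conjGenCount H g : ℝ)) / Fintype.card G) := by
  classical
  induction H using WellFoundedLT.induction with
  | ind H ih =>
    have hG : (Fintype.card G : ℝ) ≠ 0 := by exact_mod_cast Fintype.card_ne_zero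
    have h1 := (h H).sub (HasPrimeMean.sum {H' | H' < H} fun H' hH' ↦
      ih H' (by simpa using hH'))
    have h2 (g : G) : (conjMemCount H g : ℝ) - ∑ H' with H' < H, (conjGenCount H' g : ℝ) =
        conjGenCount H g := by
      rw [conjMemCount_eq_sum]
      push_cast
      ring
    have h3 : (∑ g, (conjMemCount H g : ℝ)) = Fintype.card G * Nat.card H := by
      exact_mod_cast sum_conjMemCount H
    have h4 : (Nat.card H : ℝ) - ∑ H' with H' < H,
        (∑ g, (conjGenCount H' g : ℝ)) / Fintype.card G =
        (∑ g, (conjGenCount H g : ℝ)) / Fintype.card G := by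
      simp only [← h2]
      rw [Finset.sum_sub_distrib, h3, sub_div, mul_div_cancel_left₀ _ hG, Finset.sum_comm,
        Finset.sum_div]
    simp only [h2] at h1
    rwa [h4] at h1

lemma conjGenCount_zpowers_mean_pos (τ : G) :
    0 < (∑ g, (conjGenCount (Subgroup.zpowers τ) g : ℝ)) / Fintype.card G := by
  refine div_pos ?_ (by exact_mod_cast Fintype.card_pos)
  refine Finset.sum_pos' (fun _ _ ↦ Nat.cast_nonneg _) ⟨τ, Finset.mem_univ _, ?_⟩
  have : Nonempty {x : G // Subgroup.zpowers (x⁻¹ * τ * x) = Subgroup.zpowers τ} := ⟨⟨1, by simp⟩⟩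
  exact_mod_cast Nat.card_pos

end ConjugacyCounts

section Frobenius

open NumberField Ideal

variable {K : Type*} [Field K] [NumberField K]

/-- `σ` acts as a Frobenius element at some prime of `K` above `p`. -/
def IsFrobenius (p : ℕ) (σ : K ≃ₐ[ℚ] K) : Prop :=
  ∃ P : Ideal (𝓞 K), P.IsPrime ∧ (p : 𝓞 K) ∈ P ∧ ∀ x : 𝓞 K, σ • x - x ^ p ∈ P

lemma exists_isFrobenius [IsGalois ℚ K] {p : ℕ} (hp : p.Prime) :
    ∃ σ : K ≃ₐ[ℚ] K, IsFrobenius p σ := by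
  have hpm : (span {(p : ℤ)}).IsMaximal :=
    have := Fact.mk hp
    Int.ideal_span_isMaximal_of_prime p
  obtain ⟨P, hP, hPl⟩ := Ideal.exists_maximal_ideal_liesOver_of_isIntegral (S := 𝓞 K)
    (span {(p : ℤ)})
  have hpP : (p : 𝓞 K) ∈ P := by
    have : (p : ℤ) ∈ P.under ℤ := hPl.over ▸ mem_span_singleton_self _
    simpa using this
  have hP0 : P ≠ ⊥ := by
    rintro rfl
    exact hp.ne_zero (by simpa using hpP)
  have : Finite (𝓞 K ⧸ P) := Ideal.finiteQuotientOfFreeOfNeBot P hP0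
  obtain ⟨σ, hσ⟩ := IsArithFrobAt.exists_of_isInvariant ℤ (K ≃ₐ[ℚ] K) P
  refine ⟨σ, P, inferInstance, hpP, fun x ↦ ?_⟩
  have h := hσ x
  rw [← hPl.over] at h
  have hc : Nat.card (ℤ ⧸ span {(p : ℤ)}) = p := by
    rw [Nat.card_congr (Int.quotientSpanNatEquivZMod p).toEquiv, Nat.card_zmod]
  rwa [hc] at h

/-- Counting the roots of `g` modulo `p` which come from the roots `S` in `𝓞 K`. -/
lemma rootCount_eq_card_fixed {g : ℤ[X]} {S : Finset (𝓞 K)}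
    (hg : g.map (algebraMap ℤ (𝓞 K)) = ∏ γ ∈ S, (X - C γ)) {p : ℕ} (hp : p.Prime)
    {P : Ideal (𝓞 K)} (hP : P.IsPrime) (hpP : (p : 𝓞 K) ∈ P) {σ : K ≃ₐ[ℚ] K}
    (hσ : ∀ x : 𝓞 K, σ • x - x ^ p ∈ P)
    (hS : ∀ γ ∈ S, ∀ γ' ∈ S, γ - γ' ∈ P → γ = γ') :
    rootCount g p = Nat.card {γ : 𝓞 K // γ ∈ S ∧ σ • γ = γ} := by
  have := Fact.mk hp
  have hP0 : P ≠ ⊥ := by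
    rintro rfl
    exact hp.ne_zero (by simpa using hpP)
  have hPm : P.IsMaximal := hP.isMaximal hP0
  let k := 𝓞 K ⧸ P
  let _ : Field k := Ideal.Quotient.field P
  have hpk : (p : k) = 0 := by
    have := Ideal.Quotient.eq_zero_iff_mem.mpr hpP
    simpa using this
  have hchar : CharP k p := (CharP.charP_iff_prime_eq_zero hp).mpr hpk
  let m : 𝓞 K →+* k := Ideal.Quotient.mk P
  let ι : ZMod p →+* k := ZMod.castHom dvd_rfl k
  have hι : Function.Injective ι := ι.injective
  have hroot (γ : 𝓞 K) : aeval γ g = 0 ↔ γ ∈ S := by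
    rw [aeval_def, ← eval_map, hg, eval_prod, Finset.prod_eq_zero_iff]
    simp [sub_eq_zero]
  have hσS {γ : 𝓞 K} (hγ : γ ∈ S) : σ • γ ∈ S := by
    rw [← hroot] at hγ ⊢
    have := congrArg (MulSemiringAction.toAlgHom ℤ (𝓞 K) σ) hγ
    rw [← aeval_algHom_apply, map_zero] at this
    exact this
  have hmroot (y : k) : aeval y g = 0 ↔ ∃ γ ∈ S, m γ = y := by
    have h1 : g.map (algebraMap ℤ k) = (g.map (algebraMap ℤ (𝓞 K))).map m := by
      rw [Polynomial.map_map]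
      congr 1
    rw [aeval_def, ← eval_map, h1, hg, Polynomial.map_prod, eval_prod, Finset.prod_eq_zero_iff]
    simp [sub_eq_zero, @eq_comm _ y]
  have hιroot (x : ZMod p) : aeval (ι x) g = 0 ↔ aeval x g = 0 := by
    rw [← map_eq_zero_iff ι hι, aeval_def, aeval_def, hom_eval₂,
      RingHom.ext_int (ι.comp (algebraMap ℤ (ZMod p))) (algebraMap ℤ k)]
  have hfix {γ : 𝓞 K} (hγ : γ ∈ S) : m γ ^ p = m γ ↔ σ • γ = γ := by
    have h1 : m (σ • γ) = m γ ^ p := by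
      rw [← map_pow, Ideal.Quotient.eq]
      exact hσ γ
    rw [← h1, Ideal.Quotient.eq]
    exact ⟨fun h ↦ hS _ (hσS hγ) _ hγ h, fun h ↦ by rw [h, sub_self]; exact P.zero_mem⟩
  have hset : ι '' {x | aeval x g = 0} = m '' {γ | γ ∈ S ∧ σ • γ = γ} := by
    ext y
    constructor
    · rintro ⟨x, hx, rfl⟩
      obtain ⟨γ, hγ, hγx⟩ := (hmroot _).mp ((hιroot x).mpr hx)
      refine ⟨γ, ⟨hγ, (hfix hγ).mp ?_⟩, hγx⟩
      rw [hγx, ← map_pow, ZMod.pow_card]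
    · rintro ⟨γ, ⟨hγ, hγσ⟩, rfl⟩
      have h1 := (hfix hγ).mpr hγσ
      rw [← Subfield.mem_bot_iff_pow_eq_self k p] at h1
      have h2 : m γ ∈ ι.fieldRange := (bot_le : (⊥ : Subfield k) ≤ ι.fieldRange) h1
      obtain ⟨x, hx⟩ := h2
      exact ⟨x, (hιroot x).mp (hx ▸ (hmroot _).mpr ⟨γ, hγ, rfl⟩), hx⟩
  calc rootCount g p = Nat.card (ι '' {x | aeval x g = 0}) :=
        (Nat.card_image_of_injective hι _).symm
    _ = Nat.card {γ : 𝓞 K | γ ∈ S ∧ σ • γ = γ} := by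
        rw [hset]
        exact Nat.card_image_of_injOn fun γ hγ γ' hγ' h ↦
          hS γ hγ.1 γ' hγ'.1 (Ideal.Quotient.eq.mp h)

open Classical in
lemma finite_primes_not_injOn (S : Finset (𝓞 K)) :
    {p : Nat.Primes | ∃ P : Ideal (𝓞 K), P.IsPrime ∧ ((p : ℕ) : 𝓞 K) ∈ P ∧
      ¬ ∀ γ ∈ S, ∀ γ' ∈ S, γ - γ' ∈ P → γ = γ'}.Finite := by
  set D : 𝓞 K := ∏ x ∈ S.offDiag, (x.1 - x.2)
  have hD : D ≠ 0 := Finset.prod_ne_zero_iff.mpr fun x hx ↦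
    sub_ne_zero.mpr (Finset.mem_offDiag.mp hx).2.2
  set N := absNorm (span {D})
  have hN : N ≠ 0 := by simpa [N, absNorm_eq_zero_iff] using hD
  refine ((N.primeFactors.finite_toSet).preimage
    (Nat.Primes.coe_nat_injective.injOn)).subset ?_
  rintro p ⟨P, hP, hpP, h⟩
  push Not at h
  obtain ⟨γ, hγ, γ', hγ', hmem, hne⟩ := h
  have hDP : D ∈ P := P.mem_of_dvd
    (Finset.dvd_prod_of_mem _ (Finset.mem_offDiag.mpr ⟨hγ, hγ', hne⟩ : (γ, γ') ∈ S.offDiag)) hmem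
  have hNP : (N : 𝓞 K) ∈ P := (span_singleton_le_iff_mem P).mpr hDP (absNorm_mem _)
  simp only [Set.mem_preimage, Finset.mem_coe, Nat.mem_primeFactors]
  refine ⟨p.2, ?_, hN⟩
  by_contra hnd
  have hcop : IsCoprime (N : ℤ) ((p : ℕ) : ℤ) :=
    Nat.isCoprime_iff_coprime.mpr ((Nat.Prime.coprime_iff_not_dvd p.2).mpr hnd).symm
  obtain ⟨a, b, hab⟩ := hcop
  refine hP.ne_top ((eq_top_iff_one P).mpr ?_)
  have : (1 : 𝓞 K) = (a : 𝓞 K) * (N : 𝓞 K) + (b : 𝓞 K) * ((p : ℕ) : 𝓞 K) := by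
    exact_mod_cast (congrArg (Int.cast : ℤ → 𝓞 K) hab).symm
  rw [this]
  exact P.add_mem (P.mul_mem_left _ hNP) (P.mul_mem_left _ hpP)

lemma exists_finset_map_eq_prod {g : ℤ[X]} (hg : g.Monic)
    (hsep : (g.map (algebraMap ℤ ℚ)).Separable) (hsplit : (g.map (algebraMap ℤ K)).Splits) :
    ∃ S : Finset (𝓞 K), g.map (algebraMap ℤ (𝓞 K)) = ∏ γ ∈ S, (X - C γ) := by
  classical
  have hmon := hg.map (algebraMap ℤ K)
  have hsep' : (g.map (algebraMap ℤ K)).Separable := by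
    rw [IsScalarTower.algebraMap_eq ℤ ℚ K, ← Polynomial.map_map]
    exact hsep.map
  set T := (g.map (algebraMap ℤ K)).roots.toFinset
  have hT : g.map (algebraMap ℤ K) = ∏ γ ∈ T, (X - C γ) := by
    conv_lhs => rw [hsplit.eq_prod_roots_of_monic hmon]
    rw [Finset.prod, Multiset.toFinset_val, (nodup_roots hsep').dedup]
  refine ⟨T.preimage (algebraMap (𝓞 K) K) RingOfIntegers.coe_injective.injOn, ?_⟩
  refine map_injective _ (RingOfIntegers.coe_injective (K := K)) ?_
  rw [Polynomial.map_map, ← IsScalarTower.algebraMap_eq, hT, Polynomial.map_prod]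
  simp only [Polynomial.map_sub, map_X, map_C]
  rw [Finset.prod_preimage (algebraMap (𝓞 K) K) T RingOfIntegers.coe_injective.injOn
    (fun γ ↦ (X - C γ : K[X]))]
  intro x hx hx'
  refine absurd ⟨⟨x, ⟨g, hg, ?_⟩⟩, rfl⟩ hx'
  have := (mem_roots'.mp (Multiset.mem_toFinset.mp hx)).2
  rwa [IsRoot, eval_map] at this

theorem finite_rootCount_ne_card_fixed {g : ℤ[X]} (hg : g.Monic)
    (hsep : (g.map (algebraMap ℤ ℚ)).Separable) (hsplit : (g.map (algebraMap ℤ K)).Splits) :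
    {p : Nat.Primes | ∃ σ : K ≃ₐ[ℚ] K, IsFrobenius p σ ∧
      rootCount g p ≠ Nat.card {γ : K // aeval γ g = 0 ∧ σ γ = γ}}.Finite := by
  obtain ⟨S, hS⟩ := exists_finset_map_eq_prod hg hsep hsplit
  refine (finite_primes_not_injOn S).subset ?_
  rintro p ⟨σ, ⟨P, hP, hpP, hσ⟩, hne⟩
  refine ⟨P, hP, hpP, fun h ↦ hne ?_⟩
  rw [rootCount_eq_card_fixed hS p.2 hP hpP hσ h]
  have hroot (γ : K) : aeval γ g = 0 ↔ ∃ x ∈ S, (x : K) = γ := by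
    have h1 : g.map (algebraMap ℤ K) = (g.map (algebraMap ℤ (𝓞 K))).map (algebraMap (𝓞 K) K) := by
      rw [Polynomial.map_map, ← IsScalarTower.algebraMap_eq]
    rw [aeval_def, ← eval_map, h1, hS, Polynomial.map_prod, eval_prod, Finset.prod_eq_zero_iff]
    simp [sub_eq_zero, @eq_comm _ γ]
  have hsmul (x : 𝓞 K) : ((σ • x : 𝓞 K) : K) = σ x := rfl
  refine (Nat.card_image_of_injective (RingOfIntegers.coe_injective (K := K))
    {x | x ∈ S ∧ σ • x = x}).symm.trans ?_
  refine Nat.card_congr (Equiv.setCongr (t := {γ | aeval γ g = 0 ∧ σ γ = γ}) ?_)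
  ext γ
  constructor
  · rintro ⟨x, ⟨hx, hxσ⟩, rfl⟩
    exact ⟨(hroot _).mpr ⟨x, hx, rfl⟩, by rw [← hsmul, hxσ]⟩
  · rintro ⟨hγ, hγσ⟩
    obtain ⟨x, hx, rfl⟩ := (hroot _).mp hγ
    exact ⟨x, ⟨hx, RingOfIntegers.coe_injective ((hsmul x).trans hγσ)⟩, rfl⟩

end Frobenius

section ChebotarevMeans

open NumberField

lemma conjMemCount_stabilizer {G X : Type*} [Group G] [Fintype G] [MulAction G X] (θ : X) (g : G) :
    conjMemCount (MulAction.stabilizer G θ) g = Nat.card (MulAction.stabilizer G θ) *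
      Nat.card {γ : X // γ ∈ MulAction.orbit G θ ∧ g • γ = γ} := by
  classical
  have hmem (x : G) : x⁻¹ * g * x ∈ MulAction.stabilizer G θ ↔ g • x • θ = x • θ := by
    rw [MulAction.mem_stabilizer_iff, mul_assoc, mul_smul, mul_smul, inv_smul_eq_iff]
  set T : Finset X := (Finset.univ.image (fun x : G ↦ x • θ)).filter fun γ ↦ g • γ = γ
  have hT : Nat.card {γ : X // γ ∈ MulAction.orbit G θ ∧ g • γ = γ} = T.card := by
    refine Nat.subtype_card T fun γ ↦ ?_
    simp [T, MulAction.mem_orbit_iff]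
  have hfib (γ : X) (hγ : γ ∈ T) :
      (({x : G | x⁻¹ * g * x ∈ MulAction.stabilizer G θ} : Finset G).filter
        fun x ↦ x • θ = γ).card = Nat.card (MulAction.stabilizer G θ) := by
    obtain ⟨h1, h2⟩ := Finset.mem_filter.mp hγ
    obtain ⟨y, -, rfl⟩ := Finset.mem_image.mp h1
    rw [Nat.card_eq_fintype_card, ← Fintype.card_coe]
    refine Fintype.card_congr ((Equiv.mulLeft y⁻¹).subtypeEquiv fun x ↦ ?_)
    simp only [Finset.mem_filter, Finset.mem_univ, true_and, hmem, Equiv.coe_mulLeft,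
      MulAction.mem_stabilizer_iff, mul_smul, inv_smul_eq_iff]
    exact ⟨fun h ↦ h.2, fun h ↦ ⟨by rw [h, h2], h⟩⟩
  rw [hT, conjMemCount, Nat.card_eq_fintype_card, Fintype.card_subtype,
    Finset.card_eq_sum_card_fiberwise (f := fun x ↦ x • θ) (t := T), Finset.sum_congr rfl hfib,
    Finset.sum_const, smul_eq_mul, mul_comm]
  intro x hx
  simp only [Finset.coe_filter, Finset.mem_univ, true_and, Set.mem_ofPred_eq, hmem] at hx
  simpa [T] using hx

lemma exists_integral_primitive (L : Type*) [Field L] [NumberField L] :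
    ∃ θ : 𝓞 L, Algebra.adjoin ℚ {(θ : L)} = ⊤ := by
  obtain ⟨α, hα⟩ := Field.exists_primitive_element ℚ L
  obtain ⟨m, hm, hint⟩ :=
    ((IsFractionRing.isAlgebraic_iff ℤ ℚ L).mpr
      (Algebra.IsAlgebraic.isAlgebraic α)).exists_integral_multiple
  refine ⟨⟨m • α, hint⟩, ?_⟩
  have h1 : Algebra.adjoin ℚ {α} = ⊤ := by
    rw [← IntermediateField.adjoin_simple_toSubalgebra_of_isAlgebraic (Algebra.IsAlgebraic.isAlgebraic α),
      hα, IntermediateField.top_toSubalgebra]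
  rw [eq_top_iff, ← h1]
  refine Algebra.adjoin_le (Set.singleton_subset_iff.mpr ?_)
  have h2 := Subalgebra.smul_mem _ (Algebra.self_mem_adjoin_singleton ℚ (m • α)) (m : ℚ)⁻¹
  have hm' : (m : ℚ) ≠ 0 := by exact_mod_cast hm
  have h3 : (m : ℚ)⁻¹ • m • α = α := by
    rw [← Int.cast_smul_eq_zsmul ℚ, smul_smul, inv_mul_cancel₀ hm', one_smul]
  rw [h3] at h2
  exact h2

variable {K : Type*} [Field K] [NumberField K] [IsGalois ℚ K]

lemma hasPrimeMean_conjMemCount {σ : ℕ → (K ≃ₐ[ℚ] K)}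
    (hσ : ∀ p : Nat.Primes, IsFrobenius p (σ p)) (H : Subgroup (K ≃ₐ[ℚ] K)) :
    HasPrimeMean (fun p ↦ conjMemCount H (σ p)) (Nat.card H) := by
  set L := IntermediateField.fixedField H
  obtain ⟨θ, hθ⟩ := exists_integral_primitive L
  set α : K := ((θ : L) : K)
  have hstab : MulAction.stabilizer (K ≃ₐ[ℚ] K) α = H := by
    ext x
    rw [MulAction.mem_stabilizer_iff]
    refine ⟨fun h ↦ ?_, fun h ↦ (θ : L).2 ⟨x, h⟩⟩
    rw [← IntermediateField.fixingSubgroup_fixedField H]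
    intro y
    have heq : (x : K →ₐ[ℚ] K).comp L.val = L.val :=
      AlgHom.ext_of_adjoin_eq_top hθ fun z hz ↦ by
        rw [Set.mem_singleton_iff.mp hz]
        exact h
    exact DFunLike.congr_fun heq y
  have hmin : (minpoly ℤ θ).map (algebraMap ℤ ℚ) = minpoly ℚ α := by
    rw [← minpoly.isIntegrallyClosed_eq_field_fractions ℚ L θ.isIntegral]
    exact (minpoly.algebraMap_eq (algebraMap L K).injective _).symm
  have hroot (γ : K) : aeval γ (minpoly ℤ θ) = 0 ↔ γ ∈ MulAction.orbit (K ≃ₐ[ℚ] K) α := by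
    rw [← aeval_map_algebraMap ℚ, hmin]
    constructor
    · intro h
      obtain ⟨x, hx⟩ := minpoly.exists_algEquiv_of_root (Algebra.IsAlgebraic.isAlgebraic α) h
      exact ⟨x⁻¹, inv_smul_eq_iff.mpr hx.symm⟩
    · rintro ⟨x, rfl⟩
      change aeval (x α) _ = 0
      rw [← minpoly.algEquiv_eq x α]
      exact minpoly.aeval _ _
  have hfin := finite_rootCount_ne_card_fixed (K := K) (minpoly.monic θ.isIntegral)
    (hmin ▸ (minpoly.irreducible (Algebra.IsIntegral.isIntegral α)).separable)
    (by
      rw [IsScalarTower.algebraMap_eq ℤ ℚ K, ← Polynomial.map_map, hmin]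
      exact Normal.splits inferInstance α)
  have h := (hasPrimeMean_rootCount hθ).const_mul (Nat.card H)
  rw [mul_one] at h
  refine h.congr (hfin.subset fun p hp ↦ ⟨σ p, hσ p, fun he ↦ hp ?_⟩)
  have hc := conjMemCount_stabilizer α (σ p)
  rw [hstab] at hc
  simp only [hc, he, hroot, Nat.cast_mul]
  rfl

end ChebotarevMeans

section Density

open Filter Topology NumberField

lemma hasPrimeMean_one : HasPrimeMean (fun _ ↦ 1) 1 := by
  have h0 : Algebra.adjoin ℚ {((0 : 𝓞 ℚ) : ℚ)} = ⊤ := by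
    rw [eq_top_iff]
    exact fun x _ ↦ Subalgebra.algebraMap_mem (Algebra.adjoin ℚ {((0 : 𝓞 ℚ) : ℚ)}) x
  have h := hasPrimeMean_rootCount h0
  have h2 : minpoly ℤ (0 : 𝓞 ℚ) = X := by
    simpa using minpoly.eq_X_sub_C_of_algebraMap_inj (B := 𝓞 ℚ) (0 : ℤ)
      (algebraMap ℤ (𝓞 ℚ)).injective_int
  rw [h2] at h
  have h1 (p : ℕ) : rootCount (X : ℤ[X]) p = 1 := by simp [rootCount]
  simpa [h1] using h

lemma sum_mul_le_sum_mul_of_antitone {u v w : ℕ → ℝ} (hw : Antitone w) (hw0 : ∀ n, 0 ≤ w n)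
    (h : ∀ n, ∑ k ∈ Finset.range n, u k ≤ ∑ k ∈ Finset.range n, v k) (n : ℕ) :
    ∑ k ∈ Finset.range n, u k * w k ≤ ∑ k ∈ Finset.range n, v k * w k := by
  suffices H : (∑ k ∈ Finset.range n, v k - ∑ k ∈ Finset.range n, u k) * w n ≤
      ∑ k ∈ Finset.range n, v k * w k - ∑ k ∈ Finset.range n, u k * w k from
    sub_nonneg.mp ((mul_nonneg (sub_nonneg.mpr (h n)) (hw0 n)).trans H)
  induction n with
  | zero => simp
  | succ n ih =>
    refine (mul_le_mul_of_nonneg_left (hw n.le_succ) (sub_nonneg.mpr (h (n + 1)))).trans ?_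
    simp only [Finset.sum_range_succ]
    linarith

open Classical in
lemma primeSum_eq_tsum_nat (φ : ℕ → ℝ) (s : ℝ) :
    primeSum φ s =
      ∑' k : ℕ, (if (k + 1).Prime then φ (k + 1) else 0) * ((k + 1 : ℕ) : ℝ) ^ (-s) := by
  have hsucc (p : Nat.Primes) : (p : ℕ) - 1 + 1 = p := Nat.sub_add_cancel p.2.one_le
  have hinj : Function.Injective fun p : Nat.Primes ↦ (p : ℕ) - 1 := fun p q h ↦
    Nat.Primes.coe_nat_injective (by rw [← hsucc p, ← hsucc q]; exact congrArg (· + 1) h)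
  rw [← hinj.tsum_eq]
  · refine tsum_congr fun p ↦ ?_
    simp only [hsucc, p.2, if_true]
  · intro k hk
    by_cases h : (k + 1).Prime
    · exact ⟨⟨k + 1, h⟩, rfl⟩
    · simp [h] at hk

open Classical in
lemma summable_nat_of_primes {φ : ℕ → ℝ} {C s : ℝ} (h : ∀ p : Nat.Primes, |φ p| ≤ C)
    (hs : 1 < s) :
    Summable fun k : ℕ ↦
      (if (k + 1).Prime then φ (k + 1) else 0) * ((k + 1 : ℕ) : ℝ) ^ (-s) := by
  have h1 := (summable_nat_add_iff 1).mpr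
    ((Real.summable_nat_rpow (p := -s)).mpr (by linarith)) |>.mul_left C
  refine Summable.of_norm_bounded h1 fun k ↦ ?_
  rw [norm_mul, Real.norm_of_nonneg (Real.rpow_nonneg (Nat.cast_nonneg _) _)]
  refine mul_le_mul_of_nonneg_right ?_ (Real.rpow_nonneg (Nat.cast_nonneg _) _)
  split_ifs with hk
  · exact h ⟨k + 1, hk⟩
  · rw [norm_zero]
    exact (abs_nonneg _).trans (h ⟨2, Nat.prime_two⟩)

open Classical in
lemma sum_range_ite_prime_succ (A : ℕ → Prop) (n : ℕ) :
    ∑ k ∈ Finset.range n, (if (k + 1).Prime then (if A (k + 1) then (1 : ℝ) else 0) else 0) =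
      Nat.card {ℓ : ℕ // ℓ ≤ n ∧ ℓ.Prime ∧ A ℓ} := by
  simp only [← ite_and]
  rw [← Finset.sum_filter, Finset.sum_const, nsmul_eq_mul, mul_one]
  congr 1
  symm
  rw [← Finset.card_image_of_injective _ (add_left_injective 1)]
  refine Nat.subtype_card _ fun ℓ ↦ ?_
  simp only [Finset.mem_image, Finset.mem_filter, Finset.mem_range]
  constructor
  · rintro ⟨k, ⟨hk, h⟩, rfl⟩
    exact ⟨hk, h⟩
  · rintro ⟨hl, hp, h⟩
    obtain ⟨k, rfl⟩ := Nat.exists_eq_succ_of_ne_zero hp.ne_zero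
    exact ⟨k, ⟨hl, hp, h⟩, rfl⟩

instance finite_nat_le_and (n : ℕ) (A : ℕ → Prop) : Finite {ℓ : ℕ // ℓ ≤ n ∧ A ℓ} :=
  ((Set.finite_Iic n).subset fun _ h ↦ h.1 : {ℓ : ℕ | ℓ ≤ n ∧ A ℓ}.Finite).to_subtype

lemma card_prime_and_add_card_prime_and_not (A : ℕ → Prop) (n : ℕ) :
    (Nat.card {ℓ : ℕ // ℓ ≤ n ∧ ℓ.Prime ∧ A ℓ} : ℝ) +
      Nat.card {ℓ : ℕ // ℓ ≤ n ∧ ℓ.Prime ∧ ¬ A ℓ} = Nat.card {ℓ : ℕ // ℓ ≤ n ∧ ℓ.Prime} := by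
  classical
  have h := sum_range_ite_prime_succ (fun _ ↦ True) n
  simp only [and_true, if_true] at h
  rw [← sum_range_ite_prime_succ, ← sum_range_ite_prime_succ, ← h, ← Finset.sum_add_distrib]
  refine Finset.sum_congr rfl fun k _ ↦ ?_
  split_ifs <;> simp

lemma exists_card_prime_and_not_le {A : ℕ → Prop}
    (h : Tendsto (fun n : ℕ ↦ (Nat.card {ℓ : ℕ // ℓ ≤ n ∧ ℓ.Prime ∧ A ℓ} : ℝ) /
      (Nat.card {ℓ : ℕ // ℓ ≤ n ∧ ℓ.Prime} : ℝ)) atTop (𝓝 1)) {ε : ℝ} (hε : 0 < ε) :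
    ∃ N : ℕ, ∀ n : ℕ, (Nat.card {ℓ : ℕ // ℓ ≤ n ∧ ℓ.Prime ∧ ¬ A ℓ} : ℝ) ≤
      ε * Nat.card {ℓ : ℕ // ℓ ≤ n ∧ ℓ.Prime} + N := by
  obtain ⟨N, hN⟩ := eventually_atTop.mp (h.eventually (lt_mem_nhds (show 1 - ε < 1 by linarith)))
  refine ⟨N + 1, fun n ↦ ?_⟩
  have hadd := card_prime_and_add_card_prime_and_not A n
  have hπ : (0 : ℝ) ≤ Nat.card {ℓ : ℕ // ℓ ≤ n ∧ ℓ.Prime} := Nat.cast_nonneg _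
  have hA : (0 : ℝ) ≤ Nat.card {ℓ : ℕ // ℓ ≤ n ∧ ℓ.Prime ∧ A ℓ} := Nat.cast_nonneg _
  have hNpos : (0 : ℝ) ≤ N := Nat.cast_nonneg _
  push_cast
  rcases le_or_gt N n with hn | hn
  · rcases hπ.eq_or_lt with h0 | hpos
    · rw [← h0] at hadd ⊢
      linarith
    · have := (lt_div_iff₀ hpos).mp (hN n hn)
      linarith
  · have h1 : Nat.card {ℓ : ℕ // ℓ ≤ n ∧ ℓ.Prime ∧ ¬ A ℓ} ≤ n + 1 := by
      refine (Nat.card_mono (Set.finite_Iic n)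
        (fun _ h ↦ h.1 : {ℓ : ℕ | ℓ ≤ n ∧ ℓ.Prime ∧ ¬ A ℓ} ⊆ Set.Iic n)).trans ?_
      simp
    have h2 : (Nat.card {ℓ : ℕ // ℓ ≤ n ∧ ℓ.Prime ∧ ¬ A ℓ} : ℝ) ≤ N + 1 := by
      exact_mod_cast h1.trans (by omega)
    nlinarith [mul_nonneg hε.le hπ]

open Classical in
lemma primeSum_indicator_le {A : ℕ → Prop} {ε : ℝ} {N : ℕ}
    (h : ∀ n : ℕ, (Nat.card {ℓ : ℕ // ℓ ≤ n ∧ ℓ.Prime ∧ ¬ A ℓ} : ℝ) ≤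
      ε * Nat.card {ℓ : ℕ // ℓ ≤ n ∧ ℓ.Prime} + N) (hε : 0 ≤ ε) {s : ℝ} (hs : 1 < s) :
    primeSum (fun p ↦ if ¬ A p then 1 else 0) s ≤ ε * primeSum (fun _ ↦ 1) s + N := by
  rw [primeSum_eq_tsum_nat, primeSum_eq_tsum_nat]
  refine Real.tsum_le_of_sum_range_le (fun k ↦ by positivity) fun n ↦ ?_
  have hw : Antitone fun k : ℕ ↦ ((k + 1 : ℕ) : ℝ) ^ (-s) := fun a b hab ↦
    Real.rpow_le_rpow_of_nonpos (by positivity) (by exact_mod_cast Nat.succ_le_succ hab)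
      (by linarith)
  have hab := sum_mul_le_sum_mul_of_antitone
    (u := fun k ↦ if (k + 1).Prime then (if ¬ A (k + 1) then (1 : ℝ) else 0) else 0)
    (v := fun k ↦ ε * (if (k + 1).Prime then 1 else 0) + if k = 0 then (N : ℝ) else 0) hw
    (fun k ↦ by positivity) (fun m ↦ ?_) n
  · refine hab.trans ?_
    simp only [add_mul, Finset.sum_add_distrib, mul_assoc, ← Finset.mul_sum]
    refine add_le_add (mul_le_mul_of_nonneg_left ?_ hε) ?_
    · exact (summable_nat_of_primes (φ := fun _ ↦ 1) (C := 1) (by simp) hs).sum_le_tsum _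
        fun k _ ↦ by positivity
    · simp only [ite_mul, zero_mul, Finset.sum_ite_eq']
      split_ifs <;> simp
  · have h1 := sum_range_ite_prime_succ (fun _ ↦ True) m
    simp only [and_true, if_true] at h1
    have h2 := sum_range_ite_prime_succ (fun ℓ ↦ ¬ A ℓ) m
    rw [Finset.sum_add_distrib, ← Finset.mul_sum, h1]
    refine (le_of_eq (by convert h2) :
      _ ≤ (Nat.card {ℓ : ℕ // ℓ ≤ m ∧ ℓ.Prime ∧ ¬ A ℓ} : ℝ)).trans ?_
    rcases m.eq_zero_or_pos with rfl | hm
    · have : IsEmpty {ℓ : ℕ // ℓ ≤ 0 ∧ ℓ.Prime ∧ ¬ A ℓ} :=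
        ⟨fun ⟨ℓ, hl, hp, _⟩ ↦ hp.ne_zero (Nat.le_zero.mp hl)⟩
      rw [Nat.card_of_isEmpty]
      simp only [Nat.cast_zero, Finset.range_zero, Finset.sum_empty, add_zero]
      positivity
    · refine (h m).trans_eq ?_
      simp [hm]

/-- A function supported on primes of relative natural density `0` has mean value at most `0`. -/
theorem HasPrimeMean.nonpos_of_tendsto {A : ℕ → Prop}
    (h : Tendsto (fun n : ℕ ↦ (Nat.card {ℓ : ℕ // ℓ ≤ n ∧ ℓ.Prime ∧ A ℓ} : ℝ) /
      (Nat.card {ℓ : ℕ // ℓ ≤ n ∧ ℓ.Prime} : ℝ)) atTop (𝓝 1)) {φ : ℕ → ℝ} {c : ℝ}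
    (hφ : HasPrimeMean φ c) (hA : ∀ p : Nat.Primes, A p → φ p ≤ 0) : c ≤ 0 := by
  classical
  obtain ⟨⟨C, hC⟩, hlim⟩ := hφ
  have hC0 : 0 ≤ C := (abs_nonneg _).trans (hC ⟨2, Nat.prime_two⟩)
  have key (ε : ℝ) (hε : 0 < ε) : c ≤ C * ε := by
    obtain ⟨N, hN⟩ := exists_card_prime_and_not_le h hε
    have h1 := (hasPrimeMean_one.2.const_mul (C * ε)).add
      (tendsto_log_one_div_sub_one.inv_tendsto_atTop.const_mul (C * N))
    rw [mul_one, mul_zero, add_zero] at h1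
    refine le_of_tendsto_of_tendsto hlim h1 ?_
    filter_upwards [self_mem_nhdsWithin,
      tendsto_log_one_div_sub_one.eventually_gt_atTop 0] with s hs hpos
    have hs' : 1 < s := Set.mem_Ioi.mp hs
    have h2 : primeSum φ s ≤ C * primeSum (fun p ↦ if ¬ A p then 1 else 0) s := by
      rw [primeSum, primeSum, ← tsum_mul_left]
      have hb : ∀ p : Nat.Primes, |if ¬ A p then (1 : ℝ) else 0| ≤ 1 := fun p ↦ by
        split_ifs <;> simp
      refine (summable_primes_of_bounded hC hs').tsum_le_tsum (fun p ↦ ?_)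
        ((summable_primes_of_bounded (φ := fun p ↦ if ¬ A p then (1 : ℝ) else 0) hb
          hs').mul_left C)
      rw [← mul_assoc]
      refine mul_le_mul_of_nonneg_right ?_ (by positivity)
      by_cases hp : A p
      · simpa [hp] using hA p hp
      · simpa [hp] using (le_abs_self _).trans (hC p)
    have h3 := mul_le_mul_of_nonneg_left (primeSum_indicator_le hN hε.le hs') hC0
    rw [div_le_iff₀ hpos]
    refine (h2.trans h3).trans_eq ?_
    simp only [Pi.inv_apply]
    field_simp
  refine le_of_forall_pos_le_add fun δ hδ ↦ ?_
  have := key (δ / (C + 1)) (by positivity)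
  have h4 : C * (δ / (C + 1)) ≤ δ := by
    rw [mul_div_assoc', div_le_iff₀ (by linarith)]
    nlinarith
  linarith

end Density

section LocalRoots

lemma Polynomial.Separable.comp_C_mul_X {k : Type*} [Field k] {h : k[X]} (hh : h.Separable)
    {a : k} (ha : a ≠ 0) : (h.comp (C a * X)).Separable := by
  rw [separable_def, derivative_comp, derivative_C_mul_X]
  exact (isCoprime_mul_unit_left_right (isUnit_C.mpr ha.isUnit) _ _).mpr
    (IsCoprime.map hh (compRingHom (C a * X)))

lemma Polynomial.Separable.integralNormalization {k : Type*} [Field k] {h : k[X]}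
    (hh : h.Separable) (hdeg : 1 ≤ h.natDegree) : h.integralNormalization.Separable := by
  have hl : h.leadingCoeff ≠ 0 := leadingCoeff_ne_zero.mpr hh.ne_zero
  have h1 := integralNormalization_eval₂_leadingCoeff_mul hdeg (C : k →+* k[X])
    (C h.leadingCoeff⁻¹ * X)
  rw [← mul_assoc, ← C_mul, mul_inv_cancel₀ hl, C_1, one_mul, eval₂_C_X, ← C_pow] at h1
  rw [h1]
  exact (hh.comp_C_mul_X (inv_ne_zero hl)).unit_mul
    (isUnit_C.mpr (pow_ne_zero _ hl).isUnit)

lemma Polynomial.Splits.integralNormalization {k : Type*} [Field k] {h : k[X]}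
    (hh : h.Splits) : h.integralNormalization.Splits := by
  by_cases h0 : h = 0
  · simp [h0]
  have h1 := hh.scaleRoots h.leadingCoeff
  rw [← integralNormalization_mul_C_leadingCoeff] at h1
  refine Splits.of_dvd h1 ?_ (dvd_mul_right _ _)
  exact mul_ne_zero (monic_integralNormalization h0).ne_zero
    (C_ne_zero.mpr (leadingCoeff_ne_zero.mpr h0))

lemma rootCount_ne_zero_iff {g : ℤ[X]} {p : ℕ} (hp : p.Prime) :
    rootCount g p ≠ 0 ↔ ∃ x : ZMod p, aeval x g = 0 := by
  have := Fact.mk hp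
  rw [rootCount, ← Nat.pos_iff_ne_zero, Nat.card_pos_iff, nonempty_subtype]
  exact and_iff_left inferInstance

lemma rootCount_integralNormalization_ne_zero_iff {f : ℤ[X]} (hdeg : 1 ≤ f.natDegree) {p : ℕ}
    (hp : p.Prime) (hpl : ¬ (p : ℤ) ∣ f.leadingCoeff) :
    rootCount f.integralNormalization p ≠ 0 ↔ ∃ x : ZMod p, aeval x f = 0 := by
  have := Fact.mk hp
  have hl : algebraMap ℤ (ZMod p) f.leadingCoeff ≠ 0 := by
    rwa [eq_intCast, Ne, ZMod.intCast_zmod_eq_zero_iff_dvd]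
  have key (x : ZMod p) : aeval (algebraMap ℤ (ZMod p) f.leadingCoeff * x)
      f.integralNormalization = 0 ↔ aeval x f = 0 := by
    rw [aeval_def, integralNormalization_eval₂_leadingCoeff_mul hdeg, mul_eq_zero,
      or_iff_right (pow_ne_zero _ hl), aeval_def]
  rw [rootCount_ne_zero_iff hp]
  constructor
  · rintro ⟨y, hy⟩
    refine ⟨(algebraMap ℤ (ZMod p) f.leadingCoeff)⁻¹ * y, (key _).mp ?_⟩
    rwa [mul_inv_cancel_left₀ hl]
  · rintro ⟨x, hx⟩
    exact ⟨_, (key x).mpr hx⟩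

lemma finite_primes_dvd {D : ℤ} (hD : D ≠ 0) : {p : ℕ | (p : ℤ) ∣ D}.Finite :=
  (Set.finite_Iic D.natAbs).subset fun _ hp ↦
    Nat.le_of_dvd (Int.natAbs_pos.mpr hD) (Int.natCast_dvd.mp hp)

lemma exists_int_bezout {f : ℤ[X]} (hf : (f.map (Int.castRingHom ℚ)).Separable) :
    ∃ D : ℤ, D ≠ 0 ∧ ∃ u v : ℤ[X], u * f + v * derivative f = C D := by
  obtain ⟨a, b, hab⟩ := hf
  obtain ⟨d, hdmem, hd⟩ := IsLocalization.integerNormalization_spec (nonZeroDivisors ℤ) a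
  obtain ⟨e, hemem, he⟩ := IsLocalization.integerNormalization_spec (nonZeroDivisors ℤ) b
  set a' := IsLocalization.integerNormalization (nonZeroDivisors ℤ) a
  set b' := IsLocalization.integerNormalization (nonZeroDivisors ℤ) b
  refine ⟨d * e, mul_ne_zero (nonZeroDivisors.ne_zero hdmem) (nonZeroDivisors.ne_zero hemem),
    C e * a', C d * b', ?_⟩
  apply map_injective (Int.castRingHom ℚ) Int.cast_injective
  have hd' : a'.map (Int.castRingHom ℚ) = C (d : ℚ) * a := by
    rw [← smul_eq_C_mul]
    exact hd.trans (by ext; simp)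
  have he' : b'.map (Int.castRingHom ℚ) = C (e : ℚ) * b := by
    rw [← smul_eq_C_mul]
    exact he.trans (by ext; simp)
  rw [Polynomial.map_add, Polynomial.map_mul, Polynomial.map_mul, Polynomial.map_mul,
    Polynomial.map_mul, hd', he', ← derivative_map]
  rw [map_C, map_C, map_C, map_mul, C_mul, eq_intCast, eq_intCast]
  linear_combination (C (d : ℚ) * C (e : ℚ)) * hab

lemma exists_padicInt_root {f u v : ℤ[X]} {D : ℤ} (h : u * f + v * derivative f = C D)
    {p : ℕ} [Fact p.Prime] (hp : ¬ (p : ℤ) ∣ D) (hroot : ∃ x : ZMod p, aeval x f = 0) :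
    ∃ x : ℤ_[p], aeval x f = 0 := by
  obtain ⟨x, hx⟩ := hroot
  obtain ⟨a, rfl⟩ := ZMod.intCast_surjective x
  have hint {R : Type} [CommRing R] (g : ℤ[X]) : aeval (a : R) g = ((g.eval a : ℤ) : R) := by
    simpa using aeval_algebraMap_apply R a g
  rw [hint, ZMod.intCast_zmod_eq_zero_iff_dvd] at hx
  have hd : ¬ (p : ℤ) ∣ (derivative f).eval a := fun hd ↦ hp <| by
    have := congrArg (eval a) h
    rw [eval_add, eval_mul, eval_mul, eval_C] at this
    rw [← this]
    exact dvd_add (hx.mul_left _) (hd.mul_left _)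
  have hd1 : ‖aeval (a : ℤ_[p]) (derivative f)‖ = 1 := by
    rw [hint]
    exact le_antisymm (PadicInt.norm_le_one _)
      (not_lt.mp fun hlt ↦ hd ((PadicInt.norm_int_lt_one_iff_dvd _).mp hlt))
  obtain ⟨z, hz, -⟩ := hensels_lemma (F := f) (a := (a : ℤ_[p])) (by
    rw [hd1, one_pow, hint]
    exact (PadicInt.norm_int_lt_one_iff_dvd _).mpr hx)
  exact ⟨z, hz⟩

end LocalRoots

section RootsModPrimes

/-- If `g` is conjugate to a generator of `⟨τ⟩` and fixes a root, then so does `τ`. -/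
lemma exists_fixed_root_of_conjGenCount_ne_zero {K : Type*} [Field K] [NumberField K] {g : ℤ[X]}
    {σ τ : K ≃ₐ[ℚ] K} (h : conjGenCount (Subgroup.zpowers τ) σ ≠ 0)
    (hσ : ∃ γ : K, aeval γ g = 0 ∧ σ γ = γ) : ∃ γ : K, aeval γ g = 0 ∧ τ γ = γ := by
  obtain ⟨⟨x, hx⟩⟩ := (Nat.card_ne_zero.mp h).1
  obtain ⟨γ, hγ, hfix⟩ := hσ
  refine ⟨x⁻¹ γ, ?_, ?_⟩
  · have := aeval_algHom_apply ((x⁻¹ : K ≃ₐ[ℚ] K).toAlgHom.restrictScalars ℤ) γ g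
    rw [hγ, map_zero] at this
    exact this
  · have hmem : x⁻¹ * σ * x ∈ MulAction.stabilizer (K ≃ₐ[ℚ] K) (x⁻¹ γ) := by
      simp only [MulAction.mem_stabilizer_iff, AlgEquiv.smul_def, AlgEquiv.mul_apply]
      rw [← AlgEquiv.mul_apply x, mul_inv_cancel, AlgEquiv.one_apply, hfix]
    have hle := (Subgroup.zpowers_le (H := MulAction.stabilizer (K ≃ₐ[ℚ] K) (x⁻¹ γ))).mpr hmem
    rw [hx] at hle
    exact hle (Subgroup.mem_zpowers τ)

theorem finite_primes_no_root_zmod_of_splits {f : ℤ[X]} (hnc : 0 < f.natDegree)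
    (hsep : (f.map (algebraMap ℤ ℚ)).Separable) (hwi : WeaklyIntersective f)
    (K : Type*) [Field K] [NumberField K] [IsGalois ℚ K]
    (hsplit : (f.map (algebraMap ℤ K)).Splits) :
    {p : Nat.Primes | ¬ ∃ x : ZMod p, aeval x f = 0}.Finite := by
  classical
  have hf0 : f ≠ 0 := ne_zero_of_natDegree_gt hnc
  have hlQ : algebraMap ℤ ℚ f.leadingCoeff ≠ 0 := by simpa using hf0
  have hlK : algebraMap ℤ K f.leadingCoeff ≠ 0 := by simpa using hf0
  set F := f.integralNormalization with hF
  have hFsep : (F.map (algebraMap ℤ ℚ)).Separable := by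
    rw [hF, ← integralNormalization_map _ _ hlQ]
    refine hsep.integralNormalization ?_
    rwa [natDegree_map_of_leadingCoeff_ne_zero _ hlQ]
  have hFsplit : (F.map (algebraMap ℤ K)).Splits := by
    rw [hF, ← integralNormalization_map _ _ hlK]
    exact hsplit.integralNormalization
  choose! σ hσ using fun (p : ℕ) (hp : p.Prime) ↦ exists_isFrobenius (K := K) hp
  set B : Set Nat.Primes := {p | rootCount F p ≠ Nat.card {γ : K // aeval γ F = 0 ∧ σ p γ = γ} ∨
    (p : ℤ) ∣ f.leadingCoeff} with hB
  have hBfin : B.Finite := by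
    refine ((finite_rootCount_ne_card_fixed (K := K) (monic_integralNormalization hf0) hFsep
      hFsplit).subset fun p hp ↦ ⟨σ p, hσ p p.2, hp⟩).union ?_
    have := (finite_primes_dvd (leadingCoeff_ne_zero.mpr hf0)).preimage
      Nat.Primes.coe_nat_injective.injOn
    exact this
  have hroot (p : Nat.Primes) (hp : p ∉ B) : (∃ x : ZMod p, aeval x f = 0) ↔
      ∃ γ : K, aeval γ F = 0 ∧ σ p γ = γ := by
    simp only [hB, Set.mem_ofPred_eq, not_or, not_not] at hp
    have hfin : Finite {γ : K // aeval γ F = 0 ∧ σ p γ = γ} :=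
      ((F.map (algebraMap ℤ K)).roots.toFinset.finite_toSet.subset fun γ hγ ↦ by
        rw [Finset.mem_coe, Multiset.mem_toFinset,
          mem_roots ((monic_integralNormalization hf0).map _).ne_zero, IsRoot,
          eval_map_algebraMap]
        exact hγ.1 : {γ : K | aeval γ F = 0 ∧ σ p γ = γ}.Finite).to_subtype
    rw [← rootCount_integralNormalization_ne_zero_iff hnc p.2 hp.2, ← hF, hp.1,
      ← Nat.pos_iff_ne_zero, Nat.card_pos_iff, nonempty_subtype]
    exact and_iff_left hfin
  by_contra hinf
  obtain ⟨q, hq, hqB⟩ := (Set.Infinite.sdiff hinf hBfin).nonempty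
  have hτ : ¬ ∃ γ : K, aeval γ F = 0 ∧ σ q γ = γ := fun h ↦ hq ((hroot q hqB).mpr h)
  have hmean := hasPrimeMean_conjGenCount
    (fun H ↦ hasPrimeMean_conjMemCount (fun p : Nat.Primes ↦ hσ p p.2) H)
    (Subgroup.zpowers (σ q))
  refine (conjGenCount_zpowers_mean_pos (σ q)).not_ge (HasPrimeMean.nonpos_of_tendsto hwi
    (φ := fun n ↦ if ∃ p ∈ B, (p : ℕ) = n then 0 else conjGenCount (Subgroup.zpowers (σ q)) (σ n))
    (hmean.congr (hBfin.subset fun p hp ↦ ?_)) fun p hp ↦ ?_)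
  · by_contra hpB
    refine hp (if_neg ?_)
    rintro ⟨r, hr, hrp⟩
    exact hpB (Nat.Primes.coe_nat_injective hrp ▸ hr)
  · split_ifs with h
    · exact le_rfl
    · have hpB : p ∉ B := fun hpB ↦ h ⟨p, hpB, rfl⟩
      by_contra! hne
      exact hτ (exists_fixed_root_of_conjGenCount_ne_zero (Nat.cast_pos.mp hne).ne'
        ((hroot p hpB).mp hp))

theorem finite_primes_no_root_zmod {f : ℤ[X]} (hnc : 0 < f.natDegree)
    (hsep : (f.map (Int.castRingHom ℚ)).Separable) (hwi : WeaklyIntersective f) :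
    {p : Nat.Primes | ¬ ∃ x : ZMod p, aeval x f = 0}.Finite := by
  have : NumberField (f.map (Int.castRingHom ℚ)).SplittingField := { }
  have : IsGalois ℚ (f.map (Int.castRingHom ℚ)).SplittingField :=
    @IsGalois.of_separable_splitting_field ℚ _ _ _ _ (f.map (Int.castRingHom ℚ))
      (IsSplittingField.splittingField _) hsep
  refine finite_primes_no_root_zmod_of_splits hnc hsep hwi
    (f.map (Int.castRingHom ℚ)).SplittingField ?_
  have h := SplittingField.splits (f.map (Int.castRingHom ℚ))
  rw [Polynomial.map_map] at h
  exact (RingHom.ext_int _ _ : (algebraMap ℚ (f.map (Int.castRingHom ℚ)).SplittingField).comp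
    (Int.castRingHom ℚ) = algebraMap ℤ _) ▸ h

end RootsModPrimes

/-- For a nonconstant, squarefree, weakly intersective polynomial `f`, the set
of primes `ℓ` such that `f` has no root in `ℤ_ℓ` is finite. -/
theorem stmt_9 (f : Polynomial ℤ) (hnc : 0 < f.natDegree)
    (hsf : Squarefree (f.map (Int.castRingHom ℚ))) (hwi : WeaklyIntersective f) :
    {ℓ : ℕ | ∃ _ : Fact ℓ.Prime, ¬ ∃ x : ℤ_[ℓ], Polynomial.aeval x f = 0}.Finite := by
  have hsep := PerfectField.separable_iff_squarefree.mpr hsf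
  obtain ⟨D, hD, u, v, huv⟩ := exists_int_bezout hsep
  refine (((finite_primes_no_root_zmod hnc hsep hwi).image ((↑) : Nat.Primes → ℕ)).union
    (finite_primes_dvd hD)).subset ?_
  rintro p ⟨hp, hno⟩
  by_contra h
  simp only [Set.mem_union, not_or] at h
  refine hno (exists_padicInt_root huv h.2 ?_)
  by_contra hz
  exact h.1 ⟨⟨p, hp.out⟩, hz, rfl⟩
end

section
/- Let n ≥ 2 be an integer, let f ∈ ℤ[X] be squarefree (in ℚ[X]) with f(1) ≠ 0, and let S be a finite set of primes such that for every prime ℓ ∉ S the polynomial f has a root in ℤ_ℓ. Then there exist integers a and N ≥ 1 such that every integer d with d ≡ a (mod N) satisfies: for every prime ℓ there exist x, y ∈ ℚ_ℓ with d·y^n = f(x). -/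
open Polynomial

/-- A `p`-adic integer congruent to `1` modulo `n² p` is an `n`-th power. -/
theorem PadicInt.exists_pow_eq_one_add (p : ℕ) [Fact p.Prime] {n : ℕ} (hn : n ≠ 0) (w : ℤ_[p]) :
    ∃ z : ℤ_[p], z ≠ 0 ∧ z ^ n = 1 + (n : ℤ_[p]) ^ 2 * p * w := by
  have hn0 : 0 < ‖(n : ℤ_[p])‖ := norm_pos_iff.2 (Nat.cast_ne_zero.2 hn)
  have hnorm : ‖(X ^ n - C (1 + (n : ℤ_[p]) ^ 2 * p * w)).aeval (1 : ℤ_[p])‖ <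
      ‖(X ^ n - C (1 + (n : ℤ_[p]) ^ 2 * p * w)).derivative.aeval (1 : ℤ_[p])‖ ^ 2 := by
    have hpw : ‖(p : ℤ_[p])‖ * ‖w‖ < 1 :=
      (mul_le_of_le_one_right (norm_nonneg _) w.norm_le_one).trans_lt
        ((PadicInt.norm_lt_one_iff_dvd _).2 dvd_rfl)
    have h : ‖(n : ℤ_[p])‖ ^ 2 * (‖(p : ℤ_[p])‖ * ‖w‖) < ‖(n : ℤ_[p])‖ ^ 2 :=
      mul_lt_of_lt_one_right (by positivity) hpw
    have e₁ : (X ^ n - C (1 + (n : ℤ_[p]) ^ 2 * p * w)).aeval (1 : ℤ_[p]) =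
        -((n : ℤ_[p]) ^ 2 * (p * w)) := by
      rw [coe_aeval_eq_eval, eval_sub, eval_pow, eval_X, eval_C]
      ring
    have e₂ : (X ^ n - C (1 + (n : ℤ_[p]) ^ 2 * p * w)).derivative.aeval (1 : ℤ_[p]) = (n : ℤ_[p]) := by
      rw [coe_aeval_eq_eval, derivative_sub, derivative_C, derivative_X_pow]
      simp
    rw [e₁, e₂, norm_neg, norm_mul, norm_mul, norm_pow]
    exact h
  obtain ⟨z, hz, -⟩ := hensels_lemma hnorm
  rw [coe_aeval_eq_eval, eval_sub, eval_pow, eval_X, eval_C, sub_eq_zero] at hz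
  refine ⟨z, ?_, hz⟩
  rintro rfl
  rw [zero_pow hn] at hz
  exact PadicInt.prime_p.not_isUnit
    (isUnit_of_dvd_one ⟨-((n : ℤ_[p]) ^ 2 * w), by linear_combination -hz⟩)

/-- If `f` has a root in `ℤ_ℓ` for all primes `ℓ` outside a finite set, then
there is an arithmetic progression of twisting parameters `d` all of whose
twists `d·y^n = f(x)` are soluble in every `ℚ_ℓ`. -/
theorem stmt_12 (n : ℕ) (hn : 2 ≤ n) (f : Polynomial ℤ)
    (hsf : Squarefree (f.map (Int.castRingHom ℚ)))
    (hf1 : Polynomial.eval 1 f ≠ 0)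
    (S : Finset ℕ)
    (hS : ∀ (ℓ : ℕ) (_ : Fact ℓ.Prime), ℓ ∉ S → ∃ x : ℤ_[ℓ], Polynomial.aeval x f = 0) :
    ∃ a N : ℤ, 1 ≤ N ∧ ∀ d : ℤ, d ≡ a [ZMOD N] →
      ∀ (ℓ : ℕ) (_ : Fact ℓ.Prime),
        ∃ x y : ℚ_[ℓ], (d : ℚ_[ℓ]) * y ^ n = Polynomial.aeval x f := by
  have hn0 : n ≠ 0 := by omega
  set c : ℤ := eval 1 f
  set P : ℕ := ∏ p ∈ S with p.Prime, p
  have hP0 : P ≠ 0 := Finset.prod_ne_zero_iff.2 fun p hp => (Finset.mem_filter.1 hp).2.ne_zero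
  refine ⟨c, |c| * ((n : ℤ) ^ 2 * P), ?_, fun d hd ℓ hℓ => ?_⟩
  · have : 0 < |c| := abs_pos.2 hf1
    have : 0 < |c| * ((n : ℤ) ^ 2 * P) := by positivity
    omega
  by_cases hℓS : ℓ ∈ S
  · obtain ⟨q, hq⟩ : (ℓ : ℤ) ∣ P := Int.natCast_dvd_natCast.2
      (Finset.dvd_prod_of_mem (fun p => p) (Finset.mem_filter.2 ⟨hℓS, hℓ.out⟩))
    obtain ⟨t, ht⟩ : c * ((n : ℤ) ^ 2 * P) ∣ d - c :=
      (mul_dvd_mul_right (self_dvd_abs c) _).trans hd.symm.dvd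
    have hd' : d = c * (1 + (n : ℤ) ^ 2 * ℓ * (q * t)) := by
      rw [hq] at ht
      linear_combination ht
    obtain ⟨z, hz0, hz⟩ := PadicInt.exists_pow_eq_one_add ℓ hn0 ((q * t : ℤ) : ℤ_[ℓ])
    have hz' : (z : ℚ_[ℓ]) ^ n = 1 + (n : ℚ_[ℓ]) ^ 2 * ℓ * (q * t) := by
      have := congrArg ((↑) : ℤ_[ℓ] → ℚ_[ℓ]) hz
      push_cast at this
      exact this
    have hz0' : (z : ℚ_[ℓ]) ≠ 0 := fun h => hz0 (PadicInt.coe_eq_zero.1 h)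
    have hf : aeval (1 : ℚ_[ℓ]) f = c := by
      simpa using aeval_algebraMap_apply ℚ_[ℓ] (1 : ℤ) f
    refine ⟨1, (z : ℚ_[ℓ])⁻¹, ?_⟩
    rw [hf, hd']
    push_cast
    rw [← hz', inv_pow, mul_assoc, mul_inv_cancel₀ (pow_ne_zero n hz0'), mul_one]
  · obtain ⟨x, hx⟩ := hS ℓ hℓ hℓS
    refine ⟨x, 0, ?_⟩
    have := aeval_algebraMap_apply ℚ_[ℓ] x f
    rw [hx, map_zero] at this
    rw [zero_pow hn0, mul_zero]
    exact this.symm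
end
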